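/- arXiv:1607.05086 — 12 statements merged into one kernel-verified Lean document; each statement's English description precedes it below -/
import Mathlib

section
/- Let S and T be association schemes on nonempty finite sets X and Y respectively, and let f : X → Y and g : S → T be maps such that for every p ∈ S and every (x,y) ∈ p one has (f(x), f(y)) ∈ g(p) (i.e. the pair (f,g) is a morphism of association schemes). Then g(1_X) = 1_Y, and for all p, q, r ∈ S, if r ∈ p⋆q (complex multiplication in S) then g(r) ∈ g(p)⋆g(q) (complex multiplication in T); in other words, g is a homomorphism of the hypergroups associated to S and T. -/
universe u v

/-- The diagonal relation `1_X` on a set `X`. -/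
def diagRel (X : Type u) : Set (X × X) := {z : X × X | z.1 = z.2}

/-- The transpose `p*` of a binary relation `p`. -/
def transposeRel {X : Type u} (p : Set (X × X)) : Set (X × X) := {z : X × X | (z.2, z.1) ∈ p}

/-- `rels` is an association scheme on `X`: a collection of nonempty relations partitioning
`X × X`, containing the diagonal, closed under transposition, and such that all triangle sets
over a fixed triple of relations are mutually equinumerous. -/
def IsAssocScheme (X : Type u) (rels : Set (Set (X × X))) : Prop :=
  (∀ p ∈ rels, p.Nonempty) ∧
  (∀ z : X × X, ∃ p ∈ rels, z ∈ p) ∧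
  (∀ p ∈ rels, ∀ q ∈ rels, (p ∩ q).Nonempty → p = q) ∧
  diagRel X ∈ rels ∧
  (∀ p ∈ rels, transposeRel p ∈ rels) ∧
  (∀ p ∈ rels, ∀ q ∈ rels, ∀ r ∈ rels, ∀ y z y' z' : X,
    (y, z) ∈ r → (y', z') ∈ r →
    Nonempty ({x : X // (y, x) ∈ p ∧ (x, z) ∈ q} ≃ {x : X // (y', x) ∈ p ∧ (x, z') ∈ q}))

/-- The complex multiplication `p ⋆ q` of two relations of an association scheme `rels`:
`r ∈ p ⋆ q` iff `r ∈ rels` and there are `(y, z) ∈ r` and `x` with `(y, x) ∈ p`, `(x, z) ∈ q`. -/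
def cmul {X : Type u} (rels : Set (Set (X × X))) (p q : Set (X × X)) : Set (Set (X × X)) :=
  {r ∈ rels | ∃ y x z : X, (y, z) ∈ r ∧ (y, x) ∈ p ∧ (x, z) ∈ q}

/-- If `(f, g)` is a morphism between association schemes `S` on `X` and `T`
on `Y` (with `X`, `Y` nonempty finite), then `g` sends the diagonal to the diagonal and is a
homomorphism of the associated hypergroups: `r ∈ p ⋆ q` implies `g r ∈ g p ⋆ g q`. -/
theorem morphism_induces_hypergroup_hom {X : Type u} {Y : Type v}
    [Nonempty X] [Nonempty Y] [Finite X] [Finite Y]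
    {S : Set (Set (X × X))} {T : Set (Set (Y × Y))}
    (hS : IsAssocScheme X S) (hT : IsAssocScheme Y T)
    (f : X → Y) (g : Set (X × X) → Set (Y × Y))
    (hgT : ∀ p ∈ S, g p ∈ T)
    (hmor : ∀ p ∈ S, ∀ x y : X, (x, y) ∈ p → (f x, f y) ∈ g p) :
    g (diagRel X) = diagRel Y ∧
    ∀ p ∈ S, ∀ q ∈ S, ∀ r ∈ S, r ∈ cmul S p q → g r ∈ cmul T (g p) (g q) := by
  obtain ⟨_, _, _, hdS, _, _⟩ := hS
  obtain ⟨_, _, hdisj, hdT, _, _⟩ := hT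
  refine ⟨?_, ?_⟩
  · obtain ⟨x⟩ := ‹Nonempty X›
    exact hdisj _ (hgT _ hdS) _ hdT ⟨(f x, f x), hmor _ hdS x x rfl, rfl⟩
  · rintro p hp q hq r hr ⟨_, y, x, z, hyz, hyx, hxz⟩
    exact ⟨hgT r hr, f y, f x, f z, hmor r hr y z hyz, hmor p hp y x hyx, hmor q hq x z hxz⟩
end

section
/- Let S₁ and S₂ be association schemes on nonempty sets X₁ and X₂. For p ∈ S₁ and q ∈ S₂ define the relation [p,q] = {((x₁,x₂),(y₁,y₂)) ∈ (X₁×X₂) × (X₁×X₂) : (x₁,y₁) ∈ p and (x₂,y₂) ∈ q}. Then the collection S₁⊠S₂ = {[p,q] : p ∈ S₁, q ∈ S₂} is an association scheme on X₁ × X₂, and its complex multiplication satisfies: [r₁,r₂] ∈ [p₁,p₂]⋆[q₁,q₂] if and only if r₁ ∈ p₁⋆q₁ and r₂ ∈ p₂⋆q₂. Consequently the map (p,q) ↦ [p,q] is a strict homomorphism of hypergroups from the product H(S₁) × H(S₂) to H(S₁⊠S₂). -/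
universe u v

/-- The product relation `[p, q]` on `X₁ × X₂` of relations `p` on `X₁` and `q` on `X₂`. -/
def boxRel {X₁ : Type u} {X₂ : Type v} (p : Set (X₁ × X₁)) (q : Set (X₂ × X₂)) :
    Set ((X₁ × X₂) × (X₁ × X₂)) :=
  {z | (z.1.1, z.2.1) ∈ p ∧ (z.1.2, z.2.2) ∈ q}

section BoxRel

variable {X₁ : Type u} {X₂ : Type v}

theorem diagRel_prod : diagRel (X₁ × X₂) = boxRel (diagRel X₁) (diagRel X₂) :=
  Set.ext fun _ => Prod.ext_iff

/-- The triangles over box relations are pairs of triangles over the factors. -/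
def boxTriangleEquiv (p₁ q₁ : Set (X₁ × X₁)) (p₂ q₂ : Set (X₂ × X₂)) (y z : X₁ × X₂) :
    {x : X₁ × X₂ // (y, x) ∈ boxRel p₁ p₂ ∧ (x, z) ∈ boxRel q₁ q₂} ≃
      {x : X₁ // (y.1, x) ∈ p₁ ∧ (x, z.1) ∈ q₁} ×
        {x : X₂ // (y.2, x) ∈ p₂ ∧ (x, z.2) ∈ q₂} where
  toFun x := (⟨x.1.1, x.2.1.1, x.2.2.1⟩, ⟨x.1.2, x.2.1.2, x.2.2.2⟩)
  invFun x := ⟨(x.1.1, x.2.1), ⟨x.1.2.1, x.2.2.1⟩, ⟨x.1.2.2, x.2.2.2⟩⟩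

theorem IsAssocScheme.boxRel {S₁ : Set (Set (X₁ × X₁))} {S₂ : Set (Set (X₂ × X₂))}
    (h₁ : IsAssocScheme X₁ S₁) (h₂ : IsAssocScheme X₂ S₂) :
    IsAssocScheme (X₁ × X₂) {t | ∃ p ∈ S₁, ∃ q ∈ S₂, t = boxRel p q} := by
  obtain ⟨ne₁, cover₁, disj₁, diag₁, transpose₁, triangle₁⟩ := h₁
  obtain ⟨ne₂, cover₂, disj₂, diag₂, transpose₂, triangle₂⟩ := h₂
  refine ⟨?_, ?_, ?_, ⟨_, diag₁, _, diag₂, diagRel_prod⟩, ?_, ?_⟩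
  · rintro _ ⟨p, hp, q, hq, rfl⟩
    obtain ⟨a, ha⟩ := ne₁ p hp
    obtain ⟨b, hb⟩ := ne₂ q hq
    exact ⟨((a.1, b.1), (a.2, b.2)), ha, hb⟩
  · intro z
    obtain ⟨p, hp, hzp⟩ := cover₁ (z.1.1, z.2.1)
    obtain ⟨q, hq, hzq⟩ := cover₂ (z.1.2, z.2.2)
    exact ⟨_, ⟨p, hp, q, hq, rfl⟩, hzp, hzq⟩
  · rintro _ ⟨p, hp, q, hq, rfl⟩ _ ⟨p', hp', q', hq', rfl⟩ ⟨z, hz, hz'⟩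
    rw [disj₁ p hp p' hp' ⟨_, hz.1, hz'.1⟩, disj₂ q hq q' hq' ⟨_, hz.2, hz'.2⟩]
  · rintro _ ⟨p, hp, q, hq, rfl⟩
    exact ⟨_, transpose₁ p hp, _, transpose₂ q hq, rfl⟩
  · rintro _ ⟨p₁, hp₁, p₂, hp₂, rfl⟩ _ ⟨q₁, hq₁, q₂, hq₂, rfl⟩ _ ⟨r₁, hr₁, r₂, hr₂, rfl⟩
      y z y' z' hr hr'
    obtain ⟨e₁⟩ := triangle₁ p₁ hp₁ q₁ hq₁ r₁ hr₁ _ _ _ _ hr.1 hr'.1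
    obtain ⟨e₂⟩ := triangle₂ p₂ hp₂ q₂ hq₂ r₂ hr₂ _ _ _ _ hr.2 hr'.2
    exact ⟨(boxTriangleEquiv p₁ q₁ p₂ q₂ y z).trans
      ((e₁.prodCongr e₂).trans (boxTriangleEquiv p₁ q₁ p₂ q₂ y' z').symm)⟩

theorem boxRel_mem_cmul_iff {S₁ : Set (Set (X₁ × X₁))} {S₂ : Set (Set (X₂ × X₂))}
    {p₁ q₁ r₁ : Set (X₁ × X₁)} {p₂ q₂ r₂ : Set (X₂ × X₂)} (hr₁ : r₁ ∈ S₁) (hr₂ : r₂ ∈ S₂) :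
    boxRel r₁ r₂ ∈
        cmul {t | ∃ p ∈ S₁, ∃ q ∈ S₂, t = boxRel p q} (boxRel p₁ p₂) (boxRel q₁ q₂) ↔
      r₁ ∈ cmul S₁ p₁ q₁ ∧ r₂ ∈ cmul S₂ p₂ q₂ := by
  constructor
  · rintro ⟨-, y, x, z, hr, hp, hq⟩
    exact ⟨⟨hr₁, _, _, _, hr.1, hp.1, hq.1⟩, ⟨hr₂, _, _, _, hr.2, hp.2, hq.2⟩⟩
  · rintro ⟨⟨-, y₁, x₁, z₁, hyz₁, hyx₁, hxz₁⟩, ⟨-, y₂, x₂, z₂, hyz₂, hyx₂, hxz₂⟩⟩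
    exact ⟨⟨r₁, hr₁, r₂, hr₂, rfl⟩, (y₁, y₂), (x₁, x₂), (z₁, z₂),
      ⟨hyz₁, hyz₂⟩, ⟨hyx₁, hyx₂⟩, ⟨hxz₁, hxz₂⟩⟩

end BoxRel

/-- Given association schemes `S₁`, `S₂` on nonempty sets `X₁`, `X₂`, the
collection `S₁ ⊠ S₂ = {[p, q] : p ∈ S₁, q ∈ S₂}` is an association scheme on `X₁ × X₂` whose
complex multiplication satisfies `[r₁, r₂] ∈ [p₁, p₂] ⋆ [q₁, q₂]` iff `r₁ ∈ p₁ ⋆ q₁` and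
`r₂ ∈ p₂ ⋆ q₂`; consequently `(p, q) ↦ [p, q]` is a strict homomorphism of hypergroups. -/
theorem product_assocScheme {X₁ : Type u} {X₂ : Type v} [Nonempty X₁] [Nonempty X₂]
    {S₁ : Set (Set (X₁ × X₁))} {S₂ : Set (Set (X₂ × X₂))}
    (h₁ : IsAssocScheme X₁ S₁) (h₂ : IsAssocScheme X₂ S₂) :
    IsAssocScheme (X₁ × X₂) {t | ∃ p ∈ S₁, ∃ q ∈ S₂, t = boxRel p q} ∧
    (∀ p₁ ∈ S₁, ∀ q₁ ∈ S₁, ∀ r₁ ∈ S₁, ∀ p₂ ∈ S₂, ∀ q₂ ∈ S₂, ∀ r₂ ∈ S₂,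
      boxRel r₁ r₂ ∈
          cmul {t | ∃ p ∈ S₁, ∃ q ∈ S₂, t = boxRel p q} (boxRel p₁ p₂) (boxRel q₁ q₂) ↔
        r₁ ∈ cmul S₁ p₁ q₁ ∧ r₂ ∈ cmul S₂ p₂ q₂) ∧
    (∀ p₁ ∈ S₁, ∀ q₁ ∈ S₁, ∀ p₂ ∈ S₂, ∀ q₂ ∈ S₂,
      cmul {t | ∃ p ∈ S₁, ∃ q ∈ S₂, t = boxRel p q} (boxRel p₁ p₂) (boxRel q₁ q₂) =
        {t | ∃ r₁ ∈ cmul S₁ p₁ q₁, ∃ r₂ ∈ cmul S₂ p₂ q₂, t = boxRel r₁ r₂}) := by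
  refine ⟨h₁.boxRel h₂, fun _ _ _ _ _ hr₁ _ _ _ _ _ hr₂ => boxRel_mem_cmul_iff hr₁ hr₂,
    fun p₁ _ q₁ _ p₂ _ q₂ _ => Set.ext fun t => ⟨fun ht => ?_, ?_⟩⟩
  · obtain ⟨r₁, hr₁, r₂, hr₂, rfl⟩ := ht.1
    obtain ⟨hm₁, hm₂⟩ := (boxRel_mem_cmul_iff hr₁ hr₂).1 ht
    exact ⟨r₁, hm₁, r₂, hm₂, rfl⟩
  · rintro ⟨r₁, hr₁, r₂, hr₂, rfl⟩
    exact (boxRel_mem_cmul_iff hr₁.1 hr₂.1).2 ⟨hr₁, hr₂⟩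
end

section
/- If H₁ and H₂ are realizable hypergroups, then the product hypergroup H₁ × H₂, whose hyperoperation is (a₁,a₂)*(b₁,b₂) = (a₁*₁b₁) × (a₂*₂b₂), is a realizable hypergroup. Moreover, if H₁ and H₂ are finitely realizable, then H₁ × H₂ is finitely realizable. -/
universe u v

/-- A hypergroup: a multivalued operation with nonempty values, associative on subsets,
with a unique two-sided identity, unique inverses, and reversibility. -/
structure Hypergroup (H : Type u) where
  mul : H → H → Set H
  nonempty_mul : ∀ a b : H, (mul a b).Nonempty
  e : H
  inv : H → H
  assoc : ∀ a b c : H, (⋃ x ∈ mul a b, mul x c) = ⋃ y ∈ mul b c, mul a y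
  e_mul : ∀ a : H, mul e a = {a}
  mul_e : ∀ a : H, mul a e = {a}
  e_unique : ∀ e' : H, (∀ a : H, mul e' a = {a} ∧ mul a e' = {a}) → e' = e
  mem_inv_mul : ∀ a : H, e ∈ mul (inv a) a
  mem_mul_inv : ∀ a : H, e ∈ mul a (inv a)
  inv_unique : ∀ a b : H, e ∈ mul b a → e ∈ mul a b → b = inv a
  rev_left : ∀ a b c : H, c ∈ mul a b → a ∈ mul c (inv b)
  rev_right : ∀ a b c : H, c ∈ mul a b → b ∈ mul (inv a) c
/-- A hypergroup `(H, *)` is realizable if there are a nonempty set `X`, an association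
scheme on `X`, and a bijection `φ` from the scheme to `H` transporting complex
multiplication to the hyperoperation. -/
def IsRealizable {H : Type u} (hyp : Hypergroup H) : Prop :=
  ∃ (X : Type u) (_ : Nonempty X) (rels : Set (Set (X × X))),
    IsAssocScheme X rels ∧
    ∃ φ : {p : Set (X × X) // p ∈ rels} → H, Function.Bijective φ ∧
      ∀ p q r : {p : Set (X × X) // p ∈ rels},
        (r : Set (X × X)) ∈ cmul rels (p : Set (X × X)) (q : Set (X × X)) ↔
          φ r ∈ hyp.mul (φ p) (φ q)

/-- A hypergroup is finitely realizable if it is realizable over a finite set `X`. -/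
def IsFinitelyRealizable {H : Type u} (hyp : Hypergroup H) : Prop :=
  ∃ (X : Type u) (_ : Nonempty X) (_ : Finite X) (rels : Set (Set (X × X))),
    IsAssocScheme X rels ∧
    ∃ φ : {p : Set (X × X) // p ∈ rels} → H, Function.Bijective φ ∧
      ∀ p q r : {p : Set (X × X) // p ∈ rels},
        (r : Set (X × X)) ∈ cmul rels (p : Set (X × X)) (q : Set (X × X)) ↔
          φ r ∈ hyp.mul (φ p) (φ q)

/-- The relation on `X × Y` that holds when `p` holds between the first coordinates and `q`
between the second coordinates. -/
def prodRel {X Y : Type u} (p : Set (X × X)) (q : Set (Y × Y)) : Set ((X × Y) × (X × Y)) :=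
  {z | (z.1.1, z.2.1) ∈ p ∧ (z.1.2, z.2.2) ∈ q}

theorem mem_prodRel {X Y : Type u} {p : Set (X × X)} {q : Set (Y × Y)} {a b : X × Y} :
    (a, b) ∈ prodRel p q ↔ (a.1, b.1) ∈ p ∧ (a.2, b.2) ∈ q :=
  Iff.rfl

/-- The direct product of two collections of relations. -/
def prodScheme {X Y : Type u} (R : Set (Set (X × X))) (S : Set (Set (Y × Y))) :
    Set (Set ((X × Y) × (X × Y))) :=
  Set.image2 prodRel R S

theorem prodRel_nonempty {X Y : Type u} {p : Set (X × X)} {q : Set (Y × Y)}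
    (hp : p.Nonempty) (hq : q.Nonempty) : (prodRel p q).Nonempty := by
  obtain ⟨⟨a, b⟩, hp⟩ := hp
  obtain ⟨⟨c, d⟩, hq⟩ := hq
  exact ⟨((a, c), (b, d)), hp, hq⟩

theorem prodRel_diagRel (X Y : Type u) :
    prodRel (diagRel X) (diagRel Y) = diagRel (X × Y) := by
  ext ⟨⟨a, b⟩, c, d⟩
  simp [prodRel, diagRel]

/-- Intersecting product relations have equal factors, in a product of association schemes. -/
theorem IsAssocScheme.eq_and_eq_of_inter_prodRel {X Y : Type u} {R : Set (Set (X × X))}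
    {S : Set (Set (Y × Y))} (hR : IsAssocScheme X R) (hS : IsAssocScheme Y S)
    {p p' : Set (X × X)} {q q' : Set (Y × Y)} (hp : p ∈ R) (hp' : p' ∈ R) (hq : q ∈ S)
    (hq' : q' ∈ S) (h : (prodRel p q ∩ prodRel p' q').Nonempty) : p = p' ∧ q = q' := by
  obtain ⟨_, ⟨h₁, h₂⟩, h₁', h₂'⟩ := h
  exact ⟨hR.2.2.1 p hp p' hp' ⟨_, h₁, h₁'⟩, hS.2.2.1 q hq q' hq' ⟨_, h₂, h₂'⟩⟩

/-- Triangle sets of product relations are products of triangle sets. -/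
def triangleProdEquiv {X Y : Type u} (p p' : Set (X × X)) (q q' : Set (Y × Y)) (y z : X × Y) :
    {x : X × Y // (y, x) ∈ prodRel p q ∧ (x, z) ∈ prodRel p' q'} ≃
      {x : X // (y.1, x) ∈ p ∧ (x, z.1) ∈ p'} × {x : Y // (y.2, x) ∈ q ∧ (x, z.2) ∈ q'} where
  toFun x := (⟨x.1.1, x.2.1.1, x.2.2.1⟩, ⟨x.1.2, x.2.1.2, x.2.2.2⟩)
  invFun x := ⟨(x.1.1, x.2.1), ⟨x.1.2.1, x.2.2.1⟩, ⟨x.1.2.2, x.2.2.2⟩⟩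
  left_inv _ := rfl
  right_inv _ := rfl

theorem IsAssocScheme.prod {X Y : Type u} {R : Set (Set (X × X))} {S : Set (Set (Y × Y))}
    (hR : IsAssocScheme X R) (hS : IsAssocScheme Y S) :
    IsAssocScheme (X × Y) (prodScheme R S) := by
  refine ⟨?_, ?_, ?_, ?_, ?_, ?_⟩
  · rintro _ ⟨p, hp, q, hq, rfl⟩
    exact prodRel_nonempty (hR.1 p hp) (hS.1 q hq)
  · rintro ⟨a, b⟩
    obtain ⟨p, hp, hpz⟩ := hR.2.1 (a.1, b.1)
    obtain ⟨q, hq, hqz⟩ := hS.2.1 (a.2, b.2)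
    exact ⟨prodRel p q, ⟨p, hp, q, hq, rfl⟩, hpz, hqz⟩
  · rintro _ ⟨p, hp, q, hq, rfl⟩ _ ⟨p', hp', q', hq', rfl⟩ h
    obtain ⟨rfl, rfl⟩ := hR.eq_and_eq_of_inter_prodRel hS hp hp' hq hq' h
    rfl
  · exact ⟨_, hR.2.2.2.1, _, hS.2.2.2.1, prodRel_diagRel X Y⟩
  · rintro _ ⟨p, hp, q, hq, rfl⟩
    exact ⟨_, hR.2.2.2.2.1 p hp, _, hS.2.2.2.2.1 q hq, rfl⟩
  · rintro _ ⟨p, hp, q, hq, rfl⟩ _ ⟨p', hp', q', hq', rfl⟩ _ ⟨r, hr, s, hs, rfl⟩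
      y z y' z' h h'
    obtain ⟨f⟩ := hR.2.2.2.2.2 p hp p' hp' r hr _ _ _ _ h.1 h'.1
    obtain ⟨g⟩ := hS.2.2.2.2.2 q hq q' hq' s hs _ _ _ _ h.2 h'.2
    exact ⟨(triangleProdEquiv p p' q q' y z).trans
      ((f.prodCongr g).trans (triangleProdEquiv p p' q q' y' z').symm)⟩

theorem prodRel_mem_cmul_iff {X Y : Type u} {R : Set (Set (X × X))} {S : Set (Set (Y × Y))}
    {p q r : Set (X × X)} {p' q' r' : Set (Y × Y)} (hr : r ∈ R) (hr' : r' ∈ S) :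
    prodRel r r' ∈ cmul (prodScheme R S) (prodRel p p') (prodRel q q') ↔
      r ∈ cmul R p q ∧ r' ∈ cmul S p' q' := by
  constructor
  · rintro ⟨-, y, x, z, h, h₁, h₂⟩
    exact ⟨⟨hr, _, _, _, h.1, h₁.1, h₂.1⟩, ⟨hr', _, _, _, h.2, h₁.2, h₂.2⟩⟩
  · rintro ⟨⟨-, y, x, z, h, h₁, h₂⟩, -, y', x', z', h', h₁', h₂'⟩
    exact ⟨⟨r, hr, r', hr', rfl⟩, (y, y'), (x, x'), (z, z'), ⟨h, h'⟩, ⟨h₁, h₁'⟩, ⟨h₂, h₂'⟩⟩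

/-- The map sending a pair of relations of two association schemes to their product. -/
def prodSchemeMap {X Y : Type u} (R : Set (Set (X × X))) (S : Set (Set (Y × Y)))
    (a : {p // p ∈ R} × {q // q ∈ S}) : {t // t ∈ prodScheme R S} :=
  ⟨prodRel a.1 a.2, a.1, a.1.2, a.2, a.2.2, rfl⟩

theorem IsAssocScheme.prodSchemeMap_bijective {X Y : Type u} {R : Set (Set (X × X))}
    {S : Set (Set (Y × Y))} (hR : IsAssocScheme X R) (hS : IsAssocScheme Y S) :
    Function.Bijective (prodSchemeMap R S) := by
  constructor
  · rintro ⟨⟨p, hp⟩, q, hq⟩ ⟨⟨p', hp'⟩, q', hq'⟩ h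
    have h : prodRel p q = prodRel p' q' := congrArg Subtype.val h
    have hne := prodRel_nonempty (hR.1 p hp) (hS.1 q hq)
    obtain ⟨rfl, rfl⟩ := hR.eq_and_eq_of_inter_prodRel hS hp hp' hq hq' (by
      rwa [← h, Set.inter_self])
    rfl
  · rintro ⟨_, p, hp, q, hq, rfl⟩
    exact ⟨(⟨p, hp⟩, ⟨q, hq⟩), rfl⟩

/-- Realizations of two hypergroups by association schemes induce a realization of their
product by the product scheme. -/
theorem IsAssocScheme.exists_prod_realization {H₁ H₂ X Y : Type u}
    {hyp₁ : Hypergroup H₁} {hyp₂ : Hypergroup H₂} {hyp : Hypergroup (H₁ × H₂)}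
    (hmul : ∀ a b : H₁ × H₂, hyp.mul a b = (hyp₁.mul a.1 b.1) ×ˢ (hyp₂.mul a.2 b.2))
    {R : Set (Set (X × X))} {S : Set (Set (Y × Y))}
    (hR : IsAssocScheme X R) (hS : IsAssocScheme Y S)
    {φ : {p // p ∈ R} → H₁} (hφ : Function.Bijective φ)
    (hφm : ∀ p q r : {p // p ∈ R},
      (r : Set (X × X)) ∈ cmul R p q ↔ φ r ∈ hyp₁.mul (φ p) (φ q))
    {ψ : {p // p ∈ S} → H₂} (hψ : Function.Bijective ψ)
    (hψm : ∀ p q r : {p // p ∈ S},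
      (r : Set (Y × Y)) ∈ cmul S p q ↔ ψ r ∈ hyp₂.mul (ψ p) (ψ q)) :
    ∃ χ : {t // t ∈ prodScheme R S} → H₁ × H₂, Function.Bijective χ ∧
      ∀ p q r : {t // t ∈ prodScheme R S},
        (r : Set ((X × Y) × (X × Y))) ∈ cmul (prodScheme R S) p q ↔
          χ r ∈ hyp.mul (χ p) (χ q) := by
  let e := Equiv.ofBijective _ (hR.prodSchemeMap_bijective hS)
  refine ⟨Prod.map φ ψ ∘ e.symm, (hφ.prodMap hψ).comp e.symm.bijective, fun p q r => ?_⟩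
  obtain ⟨p, rfl⟩ := e.surjective p
  obtain ⟨q, rfl⟩ := e.surjective q
  obtain ⟨r, rfl⟩ := e.surjective r
  simp only [Function.comp_apply, Equiv.symm_apply_apply, hmul, Set.mem_prod, Prod.map_fst,
    Prod.map_snd, ← hφm, ← hψm]
  exact prodRel_mem_cmul_iff r.1.2 r.2.2

/-- If `H₁` and `H₂` are realizable hypergroups, then the product hypergroup
`H₁ × H₂`, with hyperoperation `(a₁, a₂) * (b₁, b₂) = (a₁ *₁ b₁) ×ˢ (a₂ *₂ b₂)`, is realizable;
if `H₁` and `H₂` are finitely realizable, so is `H₁ × H₂`. -/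
theorem product_realizable {H₁ H₂ : Type u}
    (hyp₁ : Hypergroup H₁) (hyp₂ : Hypergroup H₂) (hyp : Hypergroup (H₁ × H₂))
    (hmul : ∀ a b : H₁ × H₂, hyp.mul a b = (hyp₁.mul a.1 b.1) ×ˢ (hyp₂.mul a.2 b.2)) :
    (IsRealizable hyp₁ → IsRealizable hyp₂ → IsRealizable hyp) ∧
    (IsFinitelyRealizable hyp₁ → IsFinitelyRealizable hyp₂ → IsFinitelyRealizable hyp) := by
  constructor
  · rintro ⟨X, _, R, hR, φ, hφ, hφm⟩ ⟨Y, _, S, hS, ψ, hψ, hψm⟩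
    exact ⟨X × Y, inferInstance, prodScheme R S, hR.prod hS,
      hR.exists_prod_realization hmul hS hφ hφm hψ hψm⟩
  · rintro ⟨X, _, _, R, hR, φ, hφ, hφm⟩ ⟨Y, _, _, S, hS, ψ, hψ, hψm⟩
    exact ⟨X × Y, inferInstance, inferInstance, prodScheme R S, hR.prod hS,
      hR.exists_prod_realization hmul hS hφ hφm hψ hψm⟩
end

section
/- Let H be a realizable hypergroup and let T ⊆ H be a sub-hypergroup, i.e. e ∈ T, T is closed under inverses, t*u ⊆ T for all t,u ∈ T, and T is a hypergroup under the restricted hyperoperation. Then T is a realizable hypergroup; moreover if H is finitely realizable then T is finitely realizable. -/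
universe u v

/-- `hyp` is realized by an association scheme on the set `X`. -/
def RealizedOn {H : Type u} (hyp : Hypergroup H) (X : Type u) : Prop :=
  ∃ rels : Set (Set (X × X)), IsAssocScheme X rels ∧
    ∃ φ : {p : Set (X × X) // p ∈ rels} → H, Function.Bijective φ ∧
      ∀ p q r : {p : Set (X × X) // p ∈ rels},
        (r : Set (X × X)) ∈ cmul rels (p : Set (X × X)) (q : Set (X × X)) ↔
          φ r ∈ hyp.mul (φ p) (φ q)

/-- A realization of `hyp` on `X`, given by the map sending a pair of points to the element of
the hypergroup labelling the relation which contains it. -/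
structure IsColoring {H : Type u} (hyp : Hypergroup H) {X : Type u} (c : X → X → H) : Prop where
  exists_eq : ∀ h, ∃ x y, c x y = h
  eq_e_iff : ∀ x y, c x y = hyp.e ↔ x = y
  swap : ∀ x y, c y x = hyp.inv (c x y)
  equiv : ∀ a b y z y' z', c y z = c y' z' →
    Nonempty ({x : X // c y x = a ∧ c x z = b} ≃ {x : X // c y' x = a ∧ c x z' = b})
  mem_mul_iff : ∀ a b h, h ∈ hyp.mul a b ↔ ∃ y x z, c y z = h ∧ c y x = a ∧ c x z = b

theorem RealizedOn.exists_isColoring {H : Type u} {hyp : Hypergroup H} {X : Type u}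
    (h : RealizedOn hyp X) : ∃ c : X → X → H, IsColoring hyp c := by
  obtain ⟨rels, ⟨hne, hcov, hdisj, hdiag, htr, hequiv⟩, φ, hφ, hmul⟩ := h
  choose R hR hzR using hcov
  let c : X → X → H := fun y z => φ ⟨R (y, z), hR (y, z)⟩
  have hc : ∀ y z (r : {p : Set (X × X) // p ∈ rels}), c y z = φ r ↔ (y, z) ∈ (r : Set (X × X)) := by
    intro y z r
    constructor
    · intro h
      rw [← hφ.1 h]
      exact hzR (y, z)
    · intro h
      exact congrArg φ (Subtype.ext (hdisj _ (hR _) _ r.2 ⟨(y, z), hzR _, h⟩))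
  have hmul' : ∀ p q r : {p : Set (X × X) // p ∈ rels}, φ r ∈ hyp.mul (φ p) (φ q) ↔
      ∃ y x z, c y z = φ r ∧ c y x = φ p ∧ c x z = φ q := by
    intro p q r
    simp only [← hmul, cmul, Set.mem_ofPred_eq, hc, r.2, true_and]
  have he : φ ⟨diagRel X, hdiag⟩ = hyp.e := by
    refine hyp.e_unique _ fun a => ?_
    obtain ⟨p, rfl⟩ := hφ.2 a
    constructor
    · ext b
      obtain ⟨r, rfl⟩ := hφ.2 b
      rw [hmul', Set.mem_singleton_iff]
      constructor
      · rintro ⟨y, x, z, h1, h2, h3⟩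
        rw [hc] at h2
        obtain rfl : y = x := h2
        exact h1.symm.trans h3
      · intro h
        obtain ⟨⟨y, z⟩, hyz⟩ := hne _ r.2
        exact ⟨y, y, z, (hc _ _ _).2 hyz, (hc _ _ _).2 rfl, ((hc _ _ _).2 hyz).trans h⟩
    · ext b
      obtain ⟨r, rfl⟩ := hφ.2 b
      rw [hmul', Set.mem_singleton_iff]
      constructor
      · rintro ⟨y, x, z, h1, h2, h3⟩
        rw [hc] at h3
        obtain rfl : x = z := h3
        exact h1.symm.trans h2
      · intro h
        obtain ⟨⟨y, z⟩, hyz⟩ := hne _ r.2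
        exact ⟨y, z, z, (hc _ _ _).2 hyz, ((hc _ _ _).2 hyz).trans h, (hc _ _ _).2 rfl⟩
  have heq : ∀ x y, c x y = hyp.e ↔ x = y := by
    intro x y
    rw [← he, hc]
    rfl
  have hmem : ∀ a b h, h ∈ hyp.mul a b ↔ ∃ y x z, c y z = h ∧ c y x = a ∧ c x z = b := by
    intro a b h
    obtain ⟨p, rfl⟩ := hφ.2 a
    obtain ⟨q, rfl⟩ := hφ.2 b
    obtain ⟨r, rfl⟩ := hφ.2 h
    exact hmul' p q r
  refine ⟨c, ?_, heq, ?_, ?_, hmem⟩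
  · intro h
    obtain ⟨p, rfl⟩ := hφ.2 h
    obtain ⟨⟨y, z⟩, hyz⟩ := hne _ p.2
    exact ⟨y, z, (hc _ _ _).2 hyz⟩
  · intro x y
    exact hyp.inv_unique _ _ ((hmem _ _ _).2 ⟨y, x, y, (heq _ _).2 rfl, rfl, rfl⟩)
      ((hmem _ _ _).2 ⟨x, y, x, (heq _ _).2 rfl, rfl, rfl⟩)
  · intro a b y z y' z' h
    obtain ⟨p, rfl⟩ := hφ.2 a
    obtain ⟨q, rfl⟩ := hφ.2 b
    simp only [hc]
    exact hequiv _ p.2 _ q.2 _ (hR (y, z)) y z y' z' (hzR _) ((hc _ _ _).1 h.symm)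

theorem IsColoring.realizedOn {H : Type u} {hyp : Hypergroup H} {X : Type u} {c : X → X → H}
    (hc : IsColoring hyp c) : RealizedOn hyp X := by
  let F : H → Set (X × X) := fun h => {z | c z.1 z.2 = h}
  have hF : Function.Injective F := by
    intro a b hab
    obtain ⟨x, y, rfl⟩ := hc.exists_eq a
    have : (x, y) ∈ F b := hab ▸ (rfl : c x y = c x y)
    exact this
  have hinv : ∀ h, hyp.inv (hyp.inv h) = h := fun h =>
    (hyp.inv_unique _ _ (hyp.mem_mul_inv h) (hyp.mem_inv_mul h)).symm
  refine ⟨Set.range F, ⟨?_, ?_, ?_, ?_, ?_, ?_⟩, (Equiv.ofInjective F hF).symm,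
    Equiv.bijective _, ?_⟩
  · rintro _ ⟨h, rfl⟩
    obtain ⟨x, y, hxy⟩ := hc.exists_eq h
    exact ⟨(x, y), hxy⟩
  · exact fun z => ⟨_, ⟨c z.1 z.2, rfl⟩, rfl⟩
  · rintro _ ⟨a, rfl⟩ _ ⟨b, rfl⟩ ⟨z, hza, hzb⟩
    exact congrArg F (Eq.trans (Eq.symm hza) hzb)
  · exact ⟨hyp.e, Set.ext fun z => hc.eq_e_iff z.1 z.2⟩
  · rintro _ ⟨a, rfl⟩
    refine ⟨hyp.inv a, Set.ext fun z => ?_⟩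
    change c z.1 z.2 = hyp.inv a ↔ c z.2 z.1 = a
    rw [hc.swap z.1 z.2]
    constructor
    · intro h
      rw [h, hinv]
    · rintro rfl
      rw [hinv]
  · rintro _ ⟨a, rfl⟩ _ ⟨b, rfl⟩ _ ⟨h, rfl⟩ y z y' z' hyz hyz'
    exact hc.equiv a b y z y' z' (Eq.trans hyz (Eq.symm hyz'))
  · intro p q r
    obtain ⟨a, rfl⟩ := (Equiv.ofInjective F hF).surjective p
    obtain ⟨b, rfl⟩ := (Equiv.ofInjective F hF).surjective q
    obtain ⟨h, rfl⟩ := (Equiv.ofInjective F hF).surjective r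
    simp only [Equiv.symm_apply_apply, hc.mem_mul_iff]
    exact and_iff_right ⟨h, rfl⟩

/-- A triangle over one pair of points transfers to any other pair of the same color. -/
theorem IsColoring.exists_triangle {H : Type u} {hyp : Hypergroup H} {X : Type u} {c : X → X → H}
    (hc : IsColoring hyp c) {y x z y' z' : X} (h : c y z = c y' z') :
    ∃ x', c y' x' = c y x ∧ c x' z' = c x z := by
  obtain ⟨f⟩ := hc.equiv (c y x) (c x z) y z y' z' h
  exact ⟨_, (f ⟨x, rfl, rfl⟩).2⟩

/-- The scheme of a sub-hypergroup `T` lives on the set of points which are `T`-related to a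
fixed base point. -/
theorem IsColoring.exists_restrict {H : Type u} {hyp : Hypergroup H} {T : Set H}
    (heT : hyp.e ∈ T) (hinvT : ∀ t ∈ T, hyp.inv t ∈ T)
    (hmulT : ∀ t ∈ T, ∀ u ∈ T, hyp.mul t u ⊆ T) {hypT : Hypergroup T}
    (hres : ∀ a b : T, hypT.mul a b = {c : T | (c : H) ∈ hyp.mul (a : H) (b : H)})
    {X : Type u} {c : X → X → H} (hc : IsColoring hyp c) (x₀ : X) :
    ∃ d : {x // c x₀ x ∈ T} → {x // c x₀ x ∈ T} → T, IsColoring hypT d := by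
  have htrans : ∀ {x y z}, c x y ∈ T → c y z ∈ T → c x z ∈ T := fun {x y z} h1 h2 =>
    hmulT _ h1 _ h2 ((hc.mem_mul_iff _ _ _).2 ⟨x, y, z, rfl, rfl, rfl⟩)
  have hsymm : ∀ {x y}, c x y ∈ T → c y x ∈ T := fun {x y} h => by
    rw [hc.swap x y]
    exact hinvT _ h
  have hd : ∀ y z : {x // c x₀ x ∈ T}, c y z ∈ T := fun y z => htrans (hsymm y.2) z.2
  have he : ⟨hyp.e, heT⟩ = hypT.e := by
    refine hypT.e_unique _ fun a => ⟨?_, ?_⟩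
    · ext b
      simp [hres, hyp.e_mul, Subtype.ext_iff]
    · ext b
      simp [hres, hyp.mul_e, Subtype.ext_iff]
  have hinv : ∀ a : T, ⟨hyp.inv a, hinvT a a.2⟩ = hypT.inv a := by
    intro a
    refine hypT.inv_unique _ _ ?_ ?_
    · rw [← he, hres]
      exact hyp.mem_inv_mul a
    · rw [← he, hres]
      exact hyp.mem_mul_inv a
  have hrefl : ∀ x, c x x = hyp.e := fun x => (hc.eq_e_iff x x).2 rfl
  have hneighbor : ∀ (y : {x // c x₀ x ∈ T}) (t : T), ∃ z : {x // c x₀ x ∈ T}, c y z = t := by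
    intro y t
    obtain ⟨u, v, huv⟩ := hc.exists_eq t
    obtain ⟨z, hz, -⟩ := hc.exists_triangle (x := v) ((hrefl u).trans (hrefl y).symm)
    have hyz : c y z = t := hz.trans huv
    exact ⟨⟨z, htrans y.2 (hyz ▸ t.2)⟩, hyz⟩
  have htriangles : ∀ (a b : T) (y z : {x // c x₀ x ∈ T}),
      Nonempty ({x : {x // c x₀ x ∈ T} // (⟨c y x, hd y x⟩ : T) = a ∧ (⟨c x z, hd x z⟩ : T) = b} ≃
        {x : X // c y x = a ∧ c x z = b}) := fun a b y z =>
    ⟨{  toFun := fun x => ⟨x, congrArg Subtype.val x.2.1, congrArg Subtype.val x.2.2⟩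
        invFun := fun x => ⟨⟨x, htrans y.2 (x.2.1.symm.subst (motive := (· ∈ T)) a.2)⟩, Subtype.ext x.2.1, Subtype.ext x.2.2⟩
        left_inv := fun _ => rfl
        right_inv := fun _ => rfl }⟩
  refine ⟨fun y z => ⟨c y z, hd y z⟩, ?_, ?_, ?_, ?_, ?_⟩
  · intro t
    obtain ⟨z, hz⟩ := hneighbor ⟨x₀, hrefl x₀ ▸ heT⟩ t
    exact ⟨_, z, Subtype.ext hz⟩
  · intro y z
    rw [← he, Subtype.mk.injEq, hc.eq_e_iff, Subtype.ext_iff]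
  · intro y z
    rw [← hinv]
    exact Subtype.ext (hc.swap y z)
  · intro a b y z y' z' h
    obtain ⟨f⟩ := htriangles a b y z
    obtain ⟨g⟩ := htriangles a b y' z'
    obtain ⟨k⟩ := hc.equiv a b y z y' z' (congrArg Subtype.val h)
    exact ⟨f.trans (k.trans g.symm)⟩
  · intro a b t
    rw [hres, Set.mem_ofPred_eq, hc.mem_mul_iff]
    constructor
    · rintro ⟨u, v, w, huw, huv, hvw⟩
      let y : {x // c x₀ x ∈ T} := ⟨x₀, hrefl x₀ ▸ heT⟩
      obtain ⟨z, hz⟩ := hneighbor y t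
      obtain ⟨x, hyx, hxz⟩ := hc.exists_triangle (x := v) (huw.trans hz.symm)
      exact ⟨y, ⟨x, (hyx.trans huv) ▸ a.2⟩, z, Subtype.ext hz, Subtype.ext (hyx.trans huv),
        Subtype.ext (hxz.trans hvw)⟩
    · rintro ⟨y, x, z, rfl, rfl, rfl⟩
      exact ⟨y, x, z, rfl, rfl, rfl⟩

/-- A realization on `X` restricts to a realization of the sub-hypergroup on a subset of `X`. -/
theorem RealizedOn.exists_subtype {H : Type u} {hyp : Hypergroup H} {T : Set H}
    (heT : hyp.e ∈ T) (hinvT : ∀ t ∈ T, hyp.inv t ∈ T)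
    (hmulT : ∀ t ∈ T, ∀ u ∈ T, hyp.mul t u ⊆ T) {hypT : Hypergroup T}
    (hres : ∀ a b : T, hypT.mul a b = {c : T | (c : H) ∈ hyp.mul (a : H) (b : H)})
    {X : Type u} [Nonempty X] (h : RealizedOn hyp X) :
    ∃ s : Set X, Nonempty s ∧ RealizedOn hypT s := by
  obtain ⟨c, hc⟩ := h.exists_isColoring
  obtain ⟨x₀⟩ := ‹Nonempty X›
  obtain ⟨d, hd⟩ := hc.exists_restrict heT hinvT hmulT hres x₀
  exact ⟨{x | c x₀ x ∈ T}, ⟨x₀, by simpa [(hc.eq_e_iff x₀ x₀).2 rfl] using heT⟩, hd.realizedOn⟩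

/-- A sub-hypergroup `T` of a realizable hypergroup `H` (containing the
identity, closed under inverses and products, and a hypergroup under the restricted
hyperoperation) is realizable; if `H` is finitely realizable, so is `T`. -/
theorem subhypergroup_realizable {H : Type u} (hyp : Hypergroup H) (T : Set H)
    (heT : hyp.e ∈ T) (hinvT : ∀ t ∈ T, hyp.inv t ∈ T)
    (hmulT : ∀ t ∈ T, ∀ u ∈ T, hyp.mul t u ⊆ T)
    (hypT : Hypergroup T)
    (hres : ∀ a b : T, hypT.mul a b = {c : T | (c : H) ∈ hyp.mul (a : H) (b : H)}) :
    (IsRealizable hyp → IsRealizable hypT) ∧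
    (IsFinitelyRealizable hyp → IsFinitelyRealizable hypT) := by
  constructor
  · rintro ⟨X, _, h⟩
    obtain ⟨s, hs, hT⟩ := RealizedOn.exists_subtype heT hinvT hmulT hres h
    exact ⟨s, hs, hT⟩
  · rintro ⟨X, _, _, h⟩
    obtain ⟨s, hs, hT⟩ := RealizedOn.exists_subtype heT hinvT hmulT hres h
    exact ⟨s, hs, inferInstance, hT⟩
end

section
/- Let H be a hypergroup and ≡ a congruence relation on H. Then the quotient H/≡, whose elements are the equivalence classes [a] and whose hyperoperation is [x]⊡[y] = {[z] : z ∈ x'*y' for some x', y' ∈ H with x' ≡ x and y' ≡ y}, is a hypergroup; its identity is [e] and the inverse of [a] is [a⁻¹]. -/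
universe u v

/-- Setwise equivalence of subsets: `A ≡ B` if every element of `A` is related to an element
of `B` and vice versa. -/
def SetCongr {H : Type u} (r : H → H → Prop) (A B : Set H) : Prop :=
  (∀ a ∈ A, ∃ a' ∈ B, r a a') ∧ (∀ b ∈ B, ∃ b' ∈ A, r b b')

/-- A congruence relation on a hypergroup: an equivalence relation compatible with the
hyperoperation (setwise, on both sides) and with inverses. -/
def IsCongruence {H : Type u} (hyp : Hypergroup H) (s : Setoid H) : Prop :=
  (∀ a b x y : H, s.r a x → s.r b y →
      SetCongr s.r (hyp.mul a b) (hyp.mul x y) ∧ SetCongr s.r (hyp.mul b a) (hyp.mul y x)) ∧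
  (∀ a b : H, s.r a b → s.r (hyp.inv a) (hyp.inv b))

/-- The hyperoperation on the quotient of a hypergroup by a congruence relation:
`[x] ⊡ [y] = {[z] : z ∈ x' * y' for some x' ≡ x, y' ≡ y}`. -/
def qmul {H : Type u} (hyp : Hypergroup H) (s : Setoid H) :
    Quotient s → Quotient s → Set (Quotient s) := fun A B =>
  {C | ∃ x y z : H, A = Quotient.mk s x ∧ B = Quotient.mk s y ∧
      C = Quotient.mk s z ∧ z ∈ hyp.mul x y}

theorem qmul_mk {H : Type u} {hyp : Hypergroup H} {s : Setoid H} (hc : IsCongruence hyp s)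
    (a b : H) :
    qmul hyp s (Quotient.mk s a) (Quotient.mk s b) = Quotient.mk s '' hyp.mul a b := by
  ext C
  constructor
  · rintro ⟨x, y, z, hx, hy, rfl, hz⟩
    obtain ⟨w, hw, hzw⟩ := (hc.1 a b x y (Quotient.exact hx) (Quotient.exact hy)).1.2 z hz
    exact ⟨w, hw, (Quotient.sound hzw).symm⟩
  · rintro ⟨z, hz, rfl⟩
    exact ⟨a, b, z, rfl, rfl, rfl, hz⟩

/-- The quotient of a hypergroup by a congruence relation. -/
def quotientHypergroup {H : Type u} (hyp : Hypergroup H) (s : Setoid H)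
    (hc : IsCongruence hyp s) : Hypergroup (Quotient s) where
  mul := qmul hyp s
  e := Quotient.mk s hyp.e
  inv := Quotient.map hyp.inv hc.2
  nonempty_mul := by
    rintro ⟨a⟩ ⟨b⟩
    exact (qmul_mk hc a b).symm ▸ (hyp.nonempty_mul a b).image _
  assoc := by
    rintro ⟨a⟩ ⟨b⟩ ⟨c⟩
    change (⋃ x ∈ qmul hyp s (Quotient.mk s a) (Quotient.mk s b), qmul hyp s x (Quotient.mk s c)) =
      ⋃ y ∈ qmul hyp s (Quotient.mk s b) (Quotient.mk s c), qmul hyp s (Quotient.mk s a) y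
    simp only [qmul_mk hc, Set.biUnion_image, ← Set.image_iUnion₂, hyp.assoc]
  e_mul := by
    rintro ⟨a⟩
    exact (qmul_mk hc hyp.e a).trans (by rw [hyp.e_mul, Set.image_singleton]; rfl)
  mul_e := by
    rintro ⟨a⟩
    exact (qmul_mk hc a hyp.e).trans (by rw [hyp.mul_e, Set.image_singleton]; rfl)
  e_unique := by
    rintro ⟨a⟩ h
    have h₁ := (h (Quotient.mk s hyp.e)).1.symm.trans (qmul_mk hc a hyp.e)
    rw [hyp.mul_e, Set.image_singleton, Set.singleton_eq_singleton_iff] at h₁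
    exact h₁.symm
  mem_inv_mul := by
    rintro ⟨a⟩
    exact ⟨hyp.inv a, a, hyp.e, rfl, rfl, rfl, hyp.mem_inv_mul a⟩
  mem_mul_inv := by
    rintro ⟨a⟩
    exact ⟨a, hyp.inv a, hyp.e, rfl, rfl, rfl, hyp.mem_mul_inv a⟩
  inv_unique := by
    rintro A B ⟨b, a, z, rfl, rfl, hz, h⟩ -
    have hb : Quotient.mk s b ∈ qmul hyp s (Quotient.mk s hyp.e) (Quotient.mk s (hyp.inv a)) :=
      ⟨z, hyp.inv a, b, hz, rfl, rfl, hyp.rev_left b a z h⟩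
    rw [qmul_mk hc, hyp.e_mul, Set.image_singleton] at hb
    exact hb
  rev_left := by
    rintro A B C ⟨a, b, c, rfl, rfl, rfl, h⟩
    exact ⟨c, hyp.inv b, a, rfl, rfl, rfl, hyp.rev_left a b c h⟩
  rev_right := by
    rintro A B C ⟨a, b, c, rfl, rfl, rfl, h⟩
    exact ⟨hyp.inv a, c, b, rfl, rfl, rfl, hyp.rev_right a b c h⟩

/-- The quotient of a hypergroup `H` by a congruence relation `≡`, with
hyperoperation `[x] ⊡ [y] = {[z] : z ∈ x' * y', x' ≡ x, y' ≡ y}`, is a hypergroup whose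
identity is `[e]` and in which the inverse of `[a]` is `[a⁻¹]`. -/
theorem quotient_hypergroup {H : Type u} (hyp : Hypergroup H) (s : Setoid H)
    (hc : IsCongruence hyp s) :
    ∃ hypQ : Hypergroup (Quotient s),
      hypQ.mul = qmul hyp s ∧
      hypQ.e = Quotient.mk s hyp.e ∧
      ∀ a : H, hypQ.inv (Quotient.mk s a) = Quotient.mk s (hyp.inv a) :=
  ⟨quotientHypergroup hyp s hc, rfl, rfl, fun _ => rfl⟩
end

section
/- Let H be a hypergroup. Then H is finitely realizable if and only if for every congruence relation ≡ on H, the quotient hypergroup H/≡ is finitely realizable. -/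
universe u v

/-- A coloring of the pairs of points of `X` by the elements of a hypergroup, whose color classes
form an association scheme with complex multiplication given by the hyperoperation. -/
structure IsSchemeColoring {H : Type u} (hyp : Hypergroup H) {X : Type v} (c : X → X → H) :
    Prop where
  exists_eq : ∀ h : H, ∃ y z : X, c y z = h
  eq_e_iff : ∀ y z : X, c y z = hyp.e ↔ y = z
  equinumerous : ∀ (p q : H) (y z y' z' : X), c y z = c y' z' →
    Nonempty ({x : X // c y x = p ∧ c x z = q} ≃ {x : X // c y' x = p ∧ c x z' = q})
  mem_mul_iff : ∀ (p q : H) (y z : X), c y z ∈ hyp.mul p q ↔ ∃ x, c y x = p ∧ c x z = q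

namespace IsSchemeColoring

variable {H : Type u} {hyp : Hypergroup H} {X : Type v} {c : X → X → H}

theorem color_self (hc : IsSchemeColoring hyp c) (y : X) : c y y = hyp.e :=
  (hc.eq_e_iff y y).2 rfl

theorem color_mem_mul (hc : IsSchemeColoring hyp c) (y x z : X) :
    c y z ∈ hyp.mul (c y x) (c x z) :=
  (hc.mem_mul_iff _ _ y z).2 ⟨x, rfl, rfl⟩

theorem color_swap (hc : IsSchemeColoring hyp c) (y z : X) : c z y = hyp.inv (c y z) := by
  apply hyp.inv_unique
  · rw [← hc.color_self z]
    exact hc.color_mem_mul z y z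
  · rw [← hc.color_self y]
    exact hc.color_mem_mul y z y

end IsSchemeColoring

theorem Hypergroup.inv_inv {H : Type u} (hyp : Hypergroup H) (a : H) :
    hyp.inv (hyp.inv a) = a :=
  (hyp.inv_unique _ _ (hyp.mem_mul_inv a) (hyp.mem_inv_mul a)).symm

theorem IsSchemeColoring.isFinitelyRealizable {H X : Type u} [Nonempty X] [Finite X]
    {hyp : Hypergroup H} {c : X → X → H} (hc : IsSchemeColoring hyp c) :
    IsFinitelyRealizable hyp := by
  let R : H → Set (X × X) := fun h => {z | c z.1 z.2 = h}
  have hR : Function.Injective R := by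
    intro a b hab
    obtain ⟨y, z, rfl⟩ := hc.exists_eq a
    have hz : (y, z) ∈ R b := hab ▸ (rfl : (y, z) ∈ R (c y z))
    exact hz
  have hbij : Function.Bijective (Set.rangeFactorization R) :=
    ⟨fun a b h => hR (congrArg Subtype.val h), Set.rangeFactorization_surjective⟩
  let E : H ≃ Set.range R := Equiv.ofBijective _ hbij
  refine ⟨X, inferInstance, inferInstance, Set.range R, ⟨?_, ?_, ?_, ?_, ?_, ?_⟩,
    E.symm, E.symm.bijective, ?_⟩
  · rintro _ ⟨h, rfl⟩
    obtain ⟨y, z, hyz⟩ := hc.exists_eq h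
    exact ⟨(y, z), hyz⟩
  · exact fun z => ⟨R (c z.1 z.2), ⟨_, rfl⟩, rfl⟩
  · rintro _ ⟨a, rfl⟩ _ ⟨b, rfl⟩ ⟨z, ha, hb⟩
    exact congrArg R (ha.symm.trans hb)
  · exact ⟨hyp.e, Set.ext fun z => hc.eq_e_iff z.1 z.2⟩
  · rintro _ ⟨a, rfl⟩
    refine ⟨hyp.inv a, Set.ext fun z => ?_⟩
    change c z.1 z.2 = hyp.inv a ↔ c z.2 z.1 = a
    rw [hc.color_swap z.1 z.2]
    constructor
    · intro h
      rw [h, hyp.inv_inv]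
    · rintro rfl
      exact (hyp.inv_inv _).symm
  · rintro _ ⟨p, rfl⟩ _ ⟨q, rfl⟩ _ ⟨r, rfl⟩ y z y' z' h h'
    exact hc.equinumerous p q y z y' z' (h.trans h'.symm)
  · intro p q r
    obtain ⟨p, rfl⟩ := E.surjective p
    obtain ⟨q, rfl⟩ := E.surjective q
    obtain ⟨r, rfl⟩ := E.surjective r
    simp only [Equiv.symm_apply_apply]
    constructor
    · rintro ⟨-, y, x, z, hr, hp, hq⟩
      have hr : c y z = r := hr
      exact hr ▸ (hc.mem_mul_iff p q y z).2 ⟨x, hp, hq⟩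
    · intro h
      obtain ⟨y, z, rfl⟩ := hc.exists_eq r
      obtain ⟨x, hp, hq⟩ := (hc.mem_mul_iff p q y z).1 h
      exact ⟨⟨_, rfl⟩, y, x, z, rfl, hp, hq⟩

theorem IsFinitelyRealizable.exists_coloring {H : Type u} {hyp : Hypergroup H}
    (h : IsFinitelyRealizable hyp) :
    ∃ (X : Type u) (_ : Nonempty X) (_ : Finite X) (c : X → X → H), IsSchemeColoring hyp c := by
  obtain ⟨X, hX, hfin, rels, ⟨hne, hcov, hdisj, hdiag, -, htri⟩, φ, hφ, hmul⟩ := h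
  choose R hRmem hR using hcov
  let c : X → X → H := fun y z => φ ⟨R (y, z), hRmem _⟩
  have hc (y z : X) (p : {p : Set (X × X) // p ∈ rels}) : c y z = φ p ↔ (y, z) ∈ p.1 := by
    constructor
    · intro h
      rw [← hφ.injective h]
      exact hR _
    · intro h
      exact congrArg φ (Subtype.ext (hdisj _ (hRmem _) _ p.2 ⟨_, hR _, h⟩))
  have hmem (p q : H) (y z : X) : c y z ∈ hyp.mul p q ↔ ∃ x, c y x = p ∧ c x z = q := by
    obtain ⟨p, rfl⟩ := hφ.surjective p
    obtain ⟨q, rfl⟩ := hφ.surjective q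
    simp only [hc]
    refine (hmul p q ⟨R (y, z), hRmem _⟩).symm.trans ?_
    constructor
    · rintro ⟨-, y', x', z', hr, hp, hq⟩
      obtain ⟨f⟩ := htri _ p.2 _ q.2 _ (hRmem (y, z)) y' z' y z hr (hR _)
      exact ⟨_, (f ⟨x', hp, hq⟩).2⟩
    · rintro ⟨x, hp, hq⟩
      exact ⟨hRmem _, y, x, z, hR _, hp, hq⟩
  have hsurj (h : H) : ∃ y z : X, c y z = h := by
    obtain ⟨p, rfl⟩ := hφ.surjective h
    obtain ⟨⟨y, z⟩, hyz⟩ := hne p.1 p.2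
    exact ⟨y, z, (hc y z p).2 hyz⟩
  have hd (y z : X) : c y z = φ ⟨_, hdiag⟩ ↔ y = z := hc y z ⟨_, hdiag⟩
  have he : φ ⟨_, hdiag⟩ = hyp.e := by
    apply hyp.e_unique
    intro a
    constructor <;> ext b <;> obtain ⟨y, z, rfl⟩ := hsurj b <;> rw [hmem]
    · simp [hd]
    · simp [hd]
  refine ⟨X, hX, hfin, c, hsurj, fun y z => he ▸ hd y z, ?_, hmem⟩
  intro p q y z y' z' h
  obtain ⟨p, rfl⟩ := hφ.surjective p
  obtain ⟨q, rfl⟩ := hφ.surjective q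
  simp only [hc]
  exact htri _ p.2 _ q.2 _ (hRmem (y', z')) y z y' z' ((hc y z ⟨R (y', z'), _⟩).1 h) (hR _)

namespace IsCongruence

variable {H : Type u} {hyp : Hypergroup H} {s : Setoid H}

theorem rel_of_mem_mul (hs : IsCongruence hyp s) {a b x y k : H} (ha : s.r a x) (hb : s.r b y)
    (hk : k ∈ hyp.mul a b) : ∃ l ∈ hyp.mul x y, s.r k l :=
  (hs.1 a b x y ha hb).1.1 k hk

theorem rel_of_mem_mul_left (hs : IsCongruence hyp s) {t a k : H} (ht : s.r t hyp.e)
    (hk : k ∈ hyp.mul t a) : s.r k a := by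
  obtain ⟨l, hl, hkl⟩ := hs.rel_of_mem_mul ht (s.refl a) hk
  rw [hyp.e_mul] at hl
  exact Set.mem_singleton_iff.1 hl ▸ hkl

theorem rel_of_mem_mul_right (hs : IsCongruence hyp s) {t a k : H} (ht : s.r t hyp.e)
    (hk : k ∈ hyp.mul a t) : s.r k a := by
  obtain ⟨l, hl, hkl⟩ := hs.rel_of_mem_mul (s.refl a) ht hk
  rw [hyp.mul_e] at hl
  exact Set.mem_singleton_iff.1 hl ▸ hkl

theorem inv_rel_e (hs : IsCongruence hyp s) {t : H} (ht : s.r t hyp.e) :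
    s.r (hyp.inv t) hyp.e :=
  s.symm (hs.rel_of_mem_mul_left ht (hyp.mem_mul_inv t))

/-- A congruence is determined by the class of the identity. -/
theorem exists_mem_mul_of_rel (hs : IsCongruence hyp s) {a b : H} (hab : s.r a b) :
    ∃ t, s.r t hyp.e ∧ a ∈ hyp.mul t b := by
  obtain ⟨t, ht, het⟩ :=
    hs.rel_of_mem_mul (s.symm hab) (s.refl (hyp.inv b)) (hyp.mem_mul_inv b)
  refine ⟨t, s.symm het, ?_⟩
  have h := hyp.rev_left _ _ _ ht
  rwa [hyp.inv_inv] at h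

theorem mk_e_eq (hs : IsCongruence hyp s) {hypQ : Hypergroup (Quotient s)}
    (hQ : hypQ.mul = qmul hyp s) : Quotient.mk s hyp.e = hypQ.e := by
  apply hypQ.e_unique
  intro A
  induction A using Quotient.ind with | _ a
  rw [hQ]
  constructor
  · apply Set.eq_singleton_iff_unique_mem.2
    refine ⟨⟨hyp.e, a, a, rfl, rfl, rfl, by simp [hyp.e_mul]⟩, ?_⟩
    rintro _ ⟨x, y, z, hx, hy, rfl, hz⟩
    rw [hy]
    exact Quotient.sound (hs.rel_of_mem_mul_left (s.symm (Quotient.exact hx)) hz)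
  · apply Set.eq_singleton_iff_unique_mem.2
    refine ⟨⟨a, hyp.e, a, rfl, rfl, rfl, by simp [hyp.mul_e]⟩, ?_⟩
    rintro _ ⟨x, y, z, hx, hy, rfl, hz⟩
    rw [hx]
    exact Quotient.sound (hs.rel_of_mem_mul_right (s.symm (Quotient.exact hy)) hz)

end IsCongruence

theorem Nat.card_eq_mul_of_card_fiber {A B : Type*} [Finite A] [Finite B] (f : A → B) {n : ℕ}
    (h : ∀ b, Nat.card {a // f a = b} = n) : Nat.card A = Nat.card B * n := by
  have := Fintype.ofFinite B
  rw [← Nat.card_congr (Equiv.sigmaFiberEquiv f), Nat.card_sigma]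
  simp [h]

namespace IsSchemeColoring

variable {H : Type u} {hyp : Hypergroup H} {X : Type v} {c : X → X → H} {s : Setoid H}

/-- The equivalence of points whose color is congruent to the identity. -/
def pointSetoid (hc : IsSchemeColoring hyp c) (hs : IsCongruence hyp s) : Setoid X where
  r y z := s.r (c y z) hyp.e
  iseqv := {
    refl := fun y => hc.color_self y ▸ s.refl _
    symm := fun {y z} h => hc.color_swap y z ▸ hs.inv_rel_e h
    trans := fun {y x z} h h' => s.trans (hs.rel_of_mem_mul_left h (hc.color_mem_mul y x z)) h' }

/-- The coloring induced on classes of points. -/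
def quotientColor (hc : IsSchemeColoring hyp c) (hs : IsCongruence hyp s) :
    Quotient (hc.pointSetoid hs) → Quotient (hc.pointSetoid hs) → Quotient s :=
  Quotient.map₂ c fun y y' hy z z' hz =>
    s.trans (hs.rel_of_mem_mul_left hy (hc.color_mem_mul y y' z))
      (s.symm (hs.rel_of_mem_mul_right hz (hc.color_mem_mul y' z z')))

/-- Colors in a triangle may be counted up to congruence. -/
theorem equinumerous_mk (hc : IsSchemeColoring hyp c) (P Q : Quotient s) {y z y' z' : X}
    (h : c y z = c y' z') :
    Nonempty ({x : X // Quotient.mk s (c y x) = P ∧ Quotient.mk s (c x z) = Q} ≃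
      {x : X // Quotient.mk s (c y' x) = P ∧ Quotient.mk s (c x z') = Q}) := by
  have f := fun p q => (hc.equinumerous p q y z y' z' h).some
  exact ⟨{
    toFun := fun x => ⟨f (c y x) (c x z) ⟨x, rfl, rfl⟩, by
      obtain ⟨h₁, h₂⟩ := (f (c y x) (c x z) ⟨x, rfl, rfl⟩).2
      rw [h₁, h₂]
      exact x.2⟩
    invFun := fun x => ⟨(f (c y' x) (c x z')).symm ⟨x, rfl, rfl⟩, by
      obtain ⟨h₁, h₂⟩ := ((f (c y' x) (c x z')).symm ⟨x, rfl, rfl⟩).2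
      rw [h₁, h₂]
      exact x.2⟩
    left_inv := by
      rintro ⟨x, hx⟩
      apply Subtype.ext
      have key : ∀ (p q : H) (w : {x : X // c y' x = p ∧ c x z' = q}),
          ((f (c y' w) (c w z')).symm ⟨w, rfl, rfl⟩ : X) = (f p q).symm w := by
        rintro p q ⟨w, rfl, rfl⟩
        rfl
      simp [key]
    right_inv := by
      rintro ⟨x, hx⟩
      apply Subtype.ext
      have key : ∀ (p q : H) (w : {x : X // c y x = p ∧ c x z = q}),
          (f (c y w) (c w z) ⟨w, rfl, rfl⟩ : X) = f p q w := by
        rintro p q ⟨w, rfl, rfl⟩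
        rfl
      simp [key] }⟩

theorem card_pointSetoid_class (hc : IsSchemeColoring hyp c) (hs : IsCongruence hyp s) (y y' : X) :
    Nat.card {x : X // s.r (c y x) hyp.e} = Nat.card {x : X // s.r (c y' x) hyp.e} := by
  have key (w : X) : Nat.card {x : X // s.r (c w x) hyp.e} =
      Nat.card {x : X // Quotient.mk s (c w x) = Quotient.mk s hyp.e ∧
        Quotient.mk s (c x w) = Quotient.mk s hyp.e} := by
    refine Nat.card_congr (Equiv.subtypeEquivRight fun x => ?_)
    exact ⟨fun h => ⟨Quotient.sound h, Quotient.sound ((hc.pointSetoid hs).symm h)⟩,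
      fun h => Quotient.exact h.1⟩
  rw [key, key]
  obtain ⟨f⟩ := hc.equinumerous_mk (Quotient.mk s hyp.e) (Quotient.mk s hyp.e)
    ((hc.color_self y).trans (hc.color_self y').symm)
  exact Nat.card_congr f

/-- A point may be moved inside its class so as to realize any congruent color. -/
theorem exists_rel_color_eq (hc : IsSchemeColoring hyp c) (hs : IsCongruence hyp s) {k : H}
    {y z : X} (h : s.r (c y z) k) : ∃ x, s.r (c y x) hyp.e ∧ c x z = k := by
  obtain ⟨t, ht, hk⟩ := hs.exists_mem_mul_of_rel h
  obtain ⟨x, rfl, hx⟩ := (hc.mem_mul_iff _ _ _ _).1 hk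
  exact ⟨x, ht, hx⟩

theorem card_quotient_triangle_mul [Finite X] (hc : IsSchemeColoring hyp c)
    (hs : IsCongruence hyp s) (P Q : Quotient s) (w y z : X) :
    Nat.card {x : X // Quotient.mk s (c y x) = P ∧ Quotient.mk s (c x z) = Q} =
      Nat.card {x : Quotient (hc.pointSetoid hs) //
        hc.quotientColor hs (Quotient.mk _ y) x = P ∧
        hc.quotientColor hs x (Quotient.mk _ z) = Q} *
      Nat.card {x : X // s.r (c w x) hyp.e} := by
  let f : {x : X // Quotient.mk s (c y x) = P ∧ Quotient.mk s (c x z) = Q} →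
      {x : Quotient (hc.pointSetoid hs) //
        hc.quotientColor hs (Quotient.mk _ y) x = P ∧
        hc.quotientColor hs x (Quotient.mk _ z) = Q} := fun x => ⟨Quotient.mk _ x.1, x.2⟩
  apply Nat.card_eq_mul_of_card_fiber f
  rintro ⟨x, hx⟩
  induction x using Quotient.ind with | _ x
  rw [hc.card_pointSetoid_class hs w x]
  refine Nat.card_congr ⟨fun v => ⟨v.1.1, ?_⟩, fun v => ⟨⟨v.1, ?_⟩, ?_⟩,
    fun _ => rfl, fun _ => rfl⟩
  · exact (hc.pointSetoid hs).symm (Quotient.exact (congrArg Subtype.val v.2))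
  · have hv : Quotient.mk (hc.pointSetoid hs) x = Quotient.mk _ v.1 := Quotient.sound v.2
    rw [hv] at hx
    exact hx
  · exact Subtype.ext (Quotient.sound ((hc.pointSetoid hs).symm v.2))

theorem quotient [Finite X] (hc : IsSchemeColoring hyp c) (hs : IsCongruence hyp s)
    {hypQ : Hypergroup (Quotient s)} (hQ : hypQ.mul = qmul hyp s) :
    IsSchemeColoring hypQ (hc.quotientColor hs) where
  exists_eq := by
    intro A
    induction A using Quotient.ind with | _ a
    obtain ⟨y, z, rfl⟩ := hc.exists_eq a
    exact ⟨Quotient.mk _ y, Quotient.mk _ z, rfl⟩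
  eq_e_iff := by
    intro y z
    induction y using Quotient.ind with | _ y
    induction z using Quotient.ind with | _ z
    rw [← hs.mk_e_eq hQ]
    exact (Quotient.eq (r := s) (x := c y z)).trans (Quotient.eq (r := hc.pointSetoid hs)).symm
  equinumerous := by
    intro P Q y z y' z' h
    induction y using Quotient.ind with | _ y
    induction z using Quotient.ind with | _ z
    induction y' using Quotient.ind with | _ y'
    induction z' using Quotient.ind with | _ z'
    obtain ⟨x, hx, hxz⟩ := hc.exists_rel_color_eq hs (s.symm (Quotient.exact h))
    have hyx : Quotient.mk (hc.pointSetoid hs) y' = Quotient.mk _ x := Quotient.sound hx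
    rw [hyx]
    obtain ⟨f⟩ := hc.equinumerous_mk P Q hxz.symm
    have hcard := Nat.card_congr f
    rw [hc.card_quotient_triangle_mul hs P Q y, hc.card_quotient_triangle_mul hs P Q y] at hcard
    have : Nonempty {x : X // s.r (c y x) hyp.e} := ⟨⟨y, (hc.pointSetoid hs).refl y⟩⟩
    exact Finite.card_eq.1 (Nat.eq_of_mul_eq_mul_right Nat.card_pos hcard)
  mem_mul_iff := by
    intro P Q y z
    induction y using Quotient.ind with | _ y
    induction z using Quotient.ind with | _ z
    rw [hQ]
    constructor
    · rintro ⟨p, q, k, rfl, rfl, hk, hmem⟩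
      obtain ⟨y', hy', rfl⟩ := hc.exists_rel_color_eq hs (Quotient.exact hk)
      obtain ⟨x, rfl, rfl⟩ := (hc.mem_mul_iff _ _ _ _).1 hmem
      have hyy : Quotient.mk (hc.pointSetoid hs) y = Quotient.mk _ y' := Quotient.sound hy'
      exact ⟨Quotient.mk _ x, by rw [hyy]; rfl, rfl⟩
    · rintro ⟨x, rfl, rfl⟩
      induction x using Quotient.ind with | _ x
      exact ⟨_, _, _, rfl, rfl, rfl, hc.color_mem_mul y x z⟩

end IsSchemeColoring

namespace Hypergroup

variable {H : Type u} {K : Type v}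

/-- Transport of a hypergroup structure along a bijection. -/
def transport (hyp : Hypergroup H) (f : H ≃ K) : Hypergroup K where
  mul a b := {k | f.symm k ∈ hyp.mul (f.symm a) (f.symm b)}
  nonempty_mul a b := by
    obtain ⟨k, hk⟩ := hyp.nonempty_mul (f.symm a) (f.symm b)
    exact ⟨f k, by simpa using hk⟩
  e := f hyp.e
  inv a := f (hyp.inv (f.symm a))
  assoc a b d := by
    ext k
    have h := Set.ext_iff.1 (hyp.assoc (f.symm a) (f.symm b) (f.symm d)) (f.symm k)
    simp only [Set.mem_iUnion, Set.mem_ofPred_eq, exists_prop] at h ⊢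
    rwa [f.symm.surjective.exists, f.symm.surjective.exists] at h
  e_mul a := by ext k; simp [hyp.e_mul]
  mul_e a := by ext k; simp [hyp.mul_e]
  e_unique e' h := by
    rw [← f.symm_apply_eq]
    apply hyp.e_unique
    intro a
    have h := h (f a)
    constructor <;> ext k
    · simpa using Set.ext_iff.1 h.1 (f k)
    · simpa using Set.ext_iff.1 h.2 (f k)
  mem_inv_mul a := by simpa using hyp.mem_inv_mul _
  mem_mul_inv a := by simpa using hyp.mem_mul_inv _
  inv_unique a b h h' := by
    rw [← f.symm_apply_eq]
    exact hyp.inv_unique _ _ (by simpa using h) (by simpa using h')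
  rev_left a b k h := by simpa using hyp.rev_left _ _ _ h
  rev_right a b k h := by simpa using hyp.rev_right _ _ _ h

end Hypergroup

theorem IsSchemeColoring.of_transport {H : Type u} {K X : Type*} {hyp : Hypergroup H} {f : H ≃ K}
    {c : X → X → K} (hc : IsSchemeColoring (hyp.transport f) c) :
    IsSchemeColoring hyp (fun y z => f.symm (c y z)) where
  exists_eq h := by simpa [f.symm_apply_eq] using hc.exists_eq (f h)
  eq_e_iff y z := (f.symm_apply_eq).trans (hc.eq_e_iff y z)
  equinumerous p q y z y' z' h := by
    simpa only [f.symm_apply_eq] using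
      hc.equinumerous (f p) (f q) y z y' z' (f.symm.injective h)
  mem_mul_iff p q y z := by
    simpa [Hypergroup.transport, f.symm_apply_eq] using hc.mem_mul_iff (f p) (f q) y z

theorem isCongruence_bot {H : Type u} (hyp : Hypergroup H) : IsCongruence hyp ⊥ := by
  refine ⟨?_, ?_⟩
  · rintro a b _ _ rfl rfl
    exact ⟨⟨fun k hk => ⟨k, hk, rfl⟩, fun k hk => ⟨k, hk, rfl⟩⟩,
      ⟨fun k hk => ⟨k, hk, rfl⟩, fun k hk => ⟨k, hk, rfl⟩⟩⟩
  · rintro a _ rfl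
    rfl

theorem Hypergroup.transport_bot_mul {H : Type u} (hyp : Hypergroup H)
    (f : H ≃ Quotient (⊥ : Setoid H)) (hf : ∀ a, f a = Quotient.mk _ a) :
    (hyp.transport f).mul = qmul hyp ⊥ := by
  funext A B
  ext C
  obtain ⟨a, rfl⟩ := f.surjective A
  obtain ⟨b, rfl⟩ := f.surjective B
  obtain ⟨k, rfl⟩ := f.surjective C
  simp only [transport, qmul, Set.mem_ofPred_eq, ← hf, f.apply_eq_iff_eq, f.symm_apply_apply]
  constructor
  · exact fun h => ⟨a, b, k, rfl, rfl, rfl, h⟩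
  · rintro ⟨x, y, z, rfl, rfl, rfl, h⟩
    exact h

/-- A hypergroup `H` is finitely realizable if and only if for every
congruence relation `≡` on `H` the quotient hypergroup `H/≡` is finitely realizable. -/
theorem finitelyRealizable_iff_quotients {H : Type u} (hyp : Hypergroup H) :
    IsFinitelyRealizable hyp ↔
      ∀ s : Setoid H, IsCongruence hyp s →
        ∀ hypQ : Hypergroup (Quotient s), hypQ.mul = qmul hyp s →
          IsFinitelyRealizable hypQ := by
  constructor
  · intro h s hs hypQ hQ
    obtain ⟨X, _, _, c, hc⟩ := h.exists_coloring
    have : Nonempty (Quotient (hc.pointSetoid hs)) := Nonempty.map (Quotient.mk _) ‹_›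
    exact (hc.quotient hs hQ).isFinitelyRealizable
  · intro h
    let f : H ≃ Quotient (⊥ : Setoid H) := Equiv.ofBijective (Quotient.mk _)
      ⟨fun _ _ hab => Quotient.exact hab, Quotient.mk_surjective⟩
    obtain ⟨X, _, _, c, hc⟩ := (h ⊥ (isCongruence_bot hyp) (hyp.transport f)
      (hyp.transport_bot_mul f fun _ => rfl)).exists_coloring
    exact hc.of_transport.isFinitelyRealizable
end

section
/- Let G be a group and P a subgroup of the automorphism group Aut(G). Then the partition hypergroup {G}_P, i.e. the set of P-orbits [x] in G with hyperoperation [x]*[y] = {[z] : z = x'y' for some x' ∈ [x] and y' ∈ [y]}, is a hypergroup: [e] = {e} is the unique identity, the unique inverse of [a] is [a⁻¹], the hyperoperation is associative (both ([a]*[b])*[c] and [a]*([b]*[c]) equal {[d] : d = a'b'c' for some a' ∈ [a], b' ∈ [b], c' ∈ [c]}), and reversibility holds. -/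
universe u v

/-- The orbit equivalence on a group `G` induced by a subgroup `P ≤ Aut(G)`:
`x ∼ y` iff `y = g(x)` for some `g ∈ P`. -/
def orbSetoid {G : Type u} [Group G] (P : Subgroup (MulAut G)) : Setoid G where
  r x y := ∃ g ∈ P, g x = y
  iseqv := by
    refine ⟨fun x => ⟨1, P.one_mem, rfl⟩, ?_, ?_⟩
    · rintro x y ⟨g, hg, rfl⟩
      exact ⟨g⁻¹, P.inv_mem hg, g.symm_apply_apply x⟩
    · rintro x y z ⟨g, hg, rfl⟩ ⟨h, hh, rfl⟩
      exact ⟨h * g, P.mul_mem hh hg, rfl⟩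

/-- The `P`-orbit `[x]` of `x ∈ G`, as an element of the quotient. -/
def omk {G : Type u} [Group G] (P : Subgroup (MulAut G)) (x : G) : Quotient (orbSetoid P) :=
  Quotient.mk (orbSetoid P) x

/-- The hyperoperation of the partition hypergroup `{G}_P`:
`[x] * [y] = {[x'y'] : x' ∈ [x], y' ∈ [y]}`. -/
def pmul {G : Type u} [Group G] (P : Subgroup (MulAut G)) :
    Quotient (orbSetoid P) → Quotient (orbSetoid P) → Set (Quotient (orbSetoid P)) :=
  fun A B => {C | ∃ x y : G, A = omk P x ∧ B = omk P y ∧ C = omk P (x * y)}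

/-- The `P`-orbit of `g ∈ G`, as a subset of `G`. -/
def orbSet {G : Type u} [Group G] (P : Subgroup (MulAut G)) (g : G) : Set G :=
  {y | ∃ h ∈ P, h g = y}

/-- The relation `R_{[g]} = {(x, y) : x y⁻¹ ∈ [g]}` of the partition association scheme. -/
def Rorb {G : Type u} [Group G] (P : Subgroup (MulAut G)) (g : G) : Set (G × G) :=
  {z | z.1 * z.2⁻¹ ∈ orbSet P g}

theorem omk_eq_iff {G : Type u} [Group G] (P : Subgroup (MulAut G)) (x y : G) :
    omk P x = omk P y ↔ ∃ g ∈ P, g x = y :=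
  Quotient.eq (r := orbSetoid P)

theorem omk_surjective {G : Type u} [Group G] (P : Subgroup (MulAut G)) :
    Function.Surjective (omk P) :=
  Quotient.mk_surjective

theorem omk_apply {G : Type u} [Group G] (P : Subgroup (MulAut G)) {g : MulAut G} (hg : g ∈ P)
    (x : G) : omk P (g x) = omk P x :=
  ((omk_eq_iff P x (g x)).2 ⟨g, hg, rfl⟩).symm

theorem omk_eq_omk_one_iff {G : Type u} [Group G] (P : Subgroup (MulAut G)) (x : G) :
    omk P x = omk P 1 ↔ x = 1 := by
  refine ⟨fun h => ?_, fun h => h ▸ rfl⟩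
  obtain ⟨g, -, hg⟩ := (omk_eq_iff P x 1).1 h
  exact g.map_eq_one_iff.1 hg

theorem orbSet_one {G : Type u} [Group G] (P : Subgroup (MulAut G)) : orbSet P 1 = {1} := by
  ext y
  constructor
  · rintro ⟨g, -, rfl⟩
    exact map_one g
  · rintro rfl
    exact ⟨1, P.one_mem, rfl⟩

/-- Inversion of `P`-orbits: `[a]⁻¹ = [a⁻¹]`. -/
def pinv {G : Type u} [Group G] (P : Subgroup (MulAut G)) :
    Quotient (orbSetoid P) → Quotient (orbSetoid P) :=
  Quotient.lift (fun a => omk P a⁻¹) (by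
    rintro a b ⟨g, hg, rfl⟩
    exact (omk_eq_iff P _ _).2 ⟨g, hg, map_inv g a⟩)

theorem pinv_omk {G : Type u} [Group G] (P : Subgroup (MulAut G)) (a : G) :
    pinv P (omk P a) = omk P a⁻¹ :=
  rfl

theorem omk_mul_mem_pmul {G : Type u} [Group G] (P : Subgroup (MulAut G)) (x y : G) :
    omk P (x * y) ∈ pmul P (omk P x) (omk P y) :=
  ⟨x, y, rfl, rfl, rfl⟩

theorem biUnion_pmul_left {G : Type u} [Group G] (P : Subgroup (MulAut G))
    (A B C : Quotient (orbSetoid P)) :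
    (⋃ D ∈ pmul P A B, pmul P D C) =
      {E | ∃ a b c : G, omk P a = A ∧ omk P b = B ∧ omk P c = C ∧ E = omk P (a * b * c)} := by
  ext E
  simp only [Set.mem_iUnion, exists_prop, Set.mem_ofPred_eq]
  constructor
  · rintro ⟨_, ⟨a, b, rfl, rfl, rfl⟩, z, c, hz, rfl, rfl⟩
    obtain ⟨g, hg, rfl⟩ := (omk_eq_iff P _ _).1 hz
    exact ⟨g a, g b, c, omk_apply P hg a, omk_apply P hg b, rfl, by rw [map_mul]⟩
  · rintro ⟨a, b, c, rfl, rfl, rfl, rfl⟩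
    exact ⟨_, omk_mul_mem_pmul P a b, omk_mul_mem_pmul P (a * b) c⟩

theorem biUnion_pmul_right {G : Type u} [Group G] (P : Subgroup (MulAut G))
    (A B C : Quotient (orbSetoid P)) :
    (⋃ D ∈ pmul P B C, pmul P A D) =
      {E | ∃ a b c : G, omk P a = A ∧ omk P b = B ∧ omk P c = C ∧ E = omk P (a * b * c)} := by
  ext E
  simp only [Set.mem_iUnion, exists_prop, Set.mem_ofPred_eq]
  constructor
  · rintro ⟨_, ⟨b, c, rfl, rfl, rfl⟩, a, z, rfl, hz, rfl⟩
    obtain ⟨g, hg, rfl⟩ := (omk_eq_iff P _ _).1 hz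
    exact ⟨a, g b, g c, rfl, omk_apply P hg b, omk_apply P hg c, by rw [map_mul, mul_assoc]⟩
  · rintro ⟨a, b, c, rfl, rfl, rfl, rfl⟩
    exact ⟨_, omk_mul_mem_pmul P b c, mul_assoc a b c ▸ omk_mul_mem_pmul P a (b * c)⟩

theorem pmul_one_left {G : Type u} [Group G] (P : Subgroup (MulAut G))
    (A : Quotient (orbSetoid P)) : pmul P (omk P 1) A = {A} := by
  ext C
  constructor
  · rintro ⟨x, y, hx, rfl, rfl⟩
    rw [(omk_eq_omk_one_iff P x).1 hx.symm, one_mul, Set.mem_singleton_iff]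
  · rintro rfl
    obtain ⟨a, rfl⟩ := omk_surjective P C
    exact ⟨1, a, rfl, rfl, by rw [one_mul]⟩

theorem pmul_one_right {G : Type u} [Group G] (P : Subgroup (MulAut G))
    (A : Quotient (orbSetoid P)) : pmul P A (omk P 1) = {A} := by
  ext C
  constructor
  · rintro ⟨x, y, rfl, hy, rfl⟩
    rw [(omk_eq_omk_one_iff P y).1 hy.symm, mul_one, Set.mem_singleton_iff]
  · rintro rfl
    obtain ⟨a, rfl⟩ := omk_surjective P C
    exact ⟨a, 1, rfl, rfl, by rw [mul_one]⟩

/-- The hypergroup structure on the set of `P`-orbits of `G`. -/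
def partitionHypergroup {G : Type u} [Group G] (P : Subgroup (MulAut G)) :
    Hypergroup (Quotient (orbSetoid P)) where
  mul := pmul P
  nonempty_mul A B := by
    obtain ⟨a, rfl⟩ := omk_surjective P A
    obtain ⟨b, rfl⟩ := omk_surjective P B
    exact ⟨_, omk_mul_mem_pmul P a b⟩
  e := omk P 1
  inv := pinv P
  assoc A B C := (biUnion_pmul_left P A B C).trans (biUnion_pmul_right P A B C).symm
  e_mul := pmul_one_left P
  mul_e := pmul_one_right P
  e_unique E hE :=
    Set.singleton_injective ((pmul_one_right P E).symm.trans (hE (omk P 1)).1)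
  mem_inv_mul A := by
    obtain ⟨a, rfl⟩ := omk_surjective P A
    exact ⟨a⁻¹, a, rfl, rfl, by rw [inv_mul_cancel]⟩
  mem_mul_inv A := by
    obtain ⟨a, rfl⟩ := omk_surjective P A
    exact ⟨a, a⁻¹, rfl, rfl, by rw [mul_inv_cancel]⟩
  inv_unique := by
    rintro _ _ ⟨x, y, rfl, rfl, h⟩ -
    rw [pinv_omk, eq_inv_of_mul_eq_one_left ((omk_eq_omk_one_iff P _).1 h.symm)]
  rev_left := by
    rintro _ _ _ ⟨x, y, rfl, rfl, rfl⟩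
    exact ⟨x * y, y⁻¹, rfl, rfl, by rw [mul_inv_cancel_right]⟩
  rev_right := by
    rintro _ _ _ ⟨x, y, rfl, rfl, rfl⟩
    exact ⟨x⁻¹, x * y, rfl, rfl, by rw [inv_mul_cancel_left]⟩

/-- The partition hypergroup `{G}_P` of `P`-orbits of a group `G` under a
subgroup `P ≤ Aut(G)` is a hypergroup: `[1] = {1}` is the unique identity, the unique inverse
of `[a]` is `[a⁻¹]`, and both triple products `([a]*[b])*[c]` and `[a]*([b]*[c])` equal the set
`{[a'b'c'] : a' ∈ [a], b' ∈ [b], c' ∈ [c]}`. -/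
theorem partition_hypergroup {G : Type u} [Group G] (P : Subgroup (MulAut G)) :
    orbSet P 1 = {1} ∧
    (∃ hyp : Hypergroup (Quotient (orbSetoid P)),
      hyp.mul = pmul P ∧
      hyp.e = omk P 1 ∧
      (∀ a : G, hyp.inv (omk P a) = omk P a⁻¹) ∧
      (∀ a b c : G,
        (⋃ D ∈ pmul P (omk P a) (omk P b), pmul P D (omk P c)) =
          {E | ∃ a' b' c' : G, omk P a' = omk P a ∧ omk P b' = omk P b ∧ omk P c' = omk P c ∧
            E = omk P (a' * b' * c')} ∧
        (⋃ D ∈ pmul P (omk P b) (omk P c), pmul P (omk P a) D) =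
          {E | ∃ a' b' c' : G, omk P a' = omk P a ∧ omk P b' = omk P b ∧ omk P c' = omk P c ∧
            E = omk P (a' * b' * c')})) := by
  exact ⟨orbSet_one P, partitionHypergroup P, rfl, rfl, pinv_omk P, fun a b c =>
    ⟨biUnion_pmul_left P _ _ _, biUnion_pmul_right P _ _ _⟩⟩
end

section
/- Let G be a group and P a subgroup of Aut(G). In the partition association scheme on G with relations R_{[g]} = {(x,y) ∈ G × G : xy⁻¹ ∈ [g]}, the complex multiplication satisfies: for all P-orbits [a], [b], [c], R_{[c]} ∈ R_{[a]} ⋆ R_{[b]} if and only if [c] ∈ [a]*[b] in the partition hypergroup {G}_P. Hence the bijection [g] ↦ R_{[g]} identifies the hypergroup associated to this association scheme with {G}_P, so the partition hypergroup {G}_P is realizable. -/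
universe u v

section PartitionScheme

variable {G : Type u} [Group G] (P : Subgroup (MulAut G))

theorem omk_eq_omk {x y : G} : omk P x = omk P y ↔ ∃ h ∈ P, h x = y :=
  Quotient.eq (r := orbSetoid P)

theorem omk_apply_s12 {h : MulAut G} (hh : h ∈ P) (x : G) : omk P (h x) = omk P x :=
  ((omk_eq_omk P).2 ⟨h, hh, rfl⟩).symm

theorem omk_eq_omk_one {x : G} : omk P x = omk P 1 ↔ x = 1 := by
  refine ⟨fun hx => ?_, fun hx => by rw [hx]⟩
  obtain ⟨h, -, hx⟩ := (omk_eq_omk P).1 hx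
  exact (map_eq_one_iff h h.injective).1 hx

theorem omk_inv_eq_omk_inv {x y : G} : omk P x⁻¹ = omk P y⁻¹ ↔ omk P x = omk P y := by
  simp only [omk_eq_omk, map_inv, inv_inj]

theorem mem_Rorb {g x y : G} : (x, y) ∈ Rorb P g ↔ omk P (x * y⁻¹) = omk P g :=
  (omk_eq_omk P).symm.trans eq_comm

theorem Rorb_eq_Rorb {a b : G} : Rorb P a = Rorb P b ↔ omk P a = omk P b := by
  refine ⟨fun hab => ?_, fun hab => ?_⟩
  · have ha : (a, 1) ∈ Rorb P a := (mem_Rorb P).2 (by simp)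
    rw [hab, mem_Rorb] at ha
    simpa using ha
  · ext ⟨x, y⟩
    rw [mem_Rorb, mem_Rorb, hab]

theorem diagRel_eq_Rorb_one : diagRel G = Rorb P 1 := by
  ext ⟨x, y⟩
  rw [mem_Rorb, omk_eq_omk_one, mul_inv_eq_one]
  rfl

theorem transposeRel_Rorb (g : G) : transposeRel (Rorb P g) = Rorb P g⁻¹ := by
  ext ⟨x, y⟩
  rw [mem_Rorb, ← omk_inv_eq_omk_inv, inv_inv, mul_inv_rev, inv_inv, ← mem_Rorb]
  rfl

theorem Rorb_triangle_equiv (a b c : G) {y z y' z' : G} (hyz : (y, z) ∈ Rorb P c)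
    (hyz' : (y', z') ∈ Rorb P c) :
    Nonempty ({x : G // (y, x) ∈ Rorb P a ∧ (x, z) ∈ Rorb P b} ≃
      {x : G // (y', x) ∈ Rorb P a ∧ (x, z') ∈ Rorb P b}) := by
  rw [mem_Rorb] at hyz hyz'
  obtain ⟨h, hh, hyz⟩ := (omk_eq_omk P).1 (hyz.trans hyz'.symm)
  refine ⟨(((Equiv.mulRight z⁻¹).trans h.toEquiv).trans (Equiv.mulRight z')).subtypeEquiv
    fun x => ?_⟩
  have hleft : y' * (h (x * z⁻¹) * z')⁻¹ = h (y * x⁻¹) := by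
    rw [mul_inv_rev, ← mul_assoc, ← hyz, ← map_inv, ← map_mul]
    congr 1
    group
  change _ ↔ (y', h (x * z⁻¹) * z') ∈ Rorb P a ∧ (h (x * z⁻¹) * z', z') ∈ Rorb P b
  simp only [mem_Rorb]
  rw [hleft, mul_inv_cancel_right, omk_apply_s12 P hh, omk_apply_s12 P hh]

theorem isAssocScheme_Rorb : IsAssocScheme G {R | ∃ g : G, R = Rorb P g} := by
  refine ⟨?_, ?_, ?_, ⟨1, diagRel_eq_Rorb_one P⟩, ?_, ?_⟩
  · rintro _ ⟨g, rfl⟩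
    exact ⟨(g, 1), (mem_Rorb P).2 (by simp)⟩
  · rintro ⟨x, y⟩
    exact ⟨_, ⟨x * y⁻¹, rfl⟩, (mem_Rorb P).2 rfl⟩
  · rintro _ ⟨a, rfl⟩ _ ⟨b, rfl⟩ ⟨⟨x, y⟩, ha, hb⟩
    exact (Rorb_eq_Rorb P).2 (((mem_Rorb P).1 ha).symm.trans ((mem_Rorb P).1 hb))
  · rintro _ ⟨g, rfl⟩
    exact ⟨g⁻¹, transposeRel_Rorb P g⟩
  · rintro _ ⟨a, rfl⟩ _ ⟨b, rfl⟩ _ ⟨c, rfl⟩ y z y' z' hyz hyz'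
    exact Rorb_triangle_equiv P a b c hyz hyz'

theorem Rorb_mem_cmul_iff (a b c : G) :
    Rorb P c ∈ cmul {R | ∃ g : G, R = Rorb P g} (Rorb P a) (Rorb P b) ↔
      omk P c ∈ pmul P (omk P a) (omk P b) := by
  constructor
  · rintro ⟨-, y, x, z, hc, ha, hb⟩
    rw [mem_Rorb] at hc ha hb
    exact ⟨y * x⁻¹, x * z⁻¹, ha.symm, hb.symm, by rw [← hc]; congr 1; group⟩
  · rintro ⟨x, y, ha, hb, hc⟩
    refine ⟨⟨c, rfl⟩, x * y, y, 1, ?_, ?_, ?_⟩ <;> rw [mem_Rorb] <;> simp [ha, hb, hc]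

/-- The bijection `[g] ↦ R_{[g]}` from `P`-orbits to the relations of the partition scheme. -/
noncomputable def orbitEquivRorb :
    Quotient (orbSetoid P) ≃ {R : Set (G × G) // R ∈ {R | ∃ g : G, R = Rorb P g}} :=
  Equiv.ofBijective
    (Quotient.lift (fun g => ⟨Rorb P g, g, rfl⟩) fun _ _ hab =>
      Subtype.ext ((Rorb_eq_Rorb P).2 (Quotient.sound hab)))
    ⟨by
      rintro ⟨a⟩ ⟨b⟩ hab
      exact (Rorb_eq_Rorb P).1 (congrArg Subtype.val hab), by
      rintro ⟨_, g, rfl⟩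
      exact ⟨omk P g, rfl⟩⟩

theorem orbitEquivRorb_symm_apply (g : G) :
    (orbitEquivRorb P).symm ⟨Rorb P g, g, rfl⟩ = omk P g :=
  (orbitEquivRorb P).symm_apply_apply (omk P g)

end PartitionScheme

/-- In the partition association scheme of `(G, P)`, the complex
multiplication satisfies `R_{[c]} ∈ R_{[a]} ⋆ R_{[b]}` iff `[c] ∈ [a] * [b]` in the partition
hypergroup `{G}_P`; hence the partition hypergroup `{G}_P` is realizable. -/
theorem partition_hypergroup_realizable {G : Type u} [Group G] (P : Subgroup (MulAut G))
    (hyp : Hypergroup (Quotient (orbSetoid P))) (hmul : hyp.mul = pmul P) :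
    (∀ a b c : G,
      Rorb P c ∈ cmul {R | ∃ g : G, R = Rorb P g} (Rorb P a) (Rorb P b) ↔
        omk P c ∈ pmul P (omk P a) (omk P b)) ∧
    IsRealizable hyp := by
  refine ⟨Rorb_mem_cmul_iff P, G, ⟨1⟩, _, isAssocScheme_Rorb P, (orbitEquivRorb P).symm,
    (orbitEquivRorb P).symm.bijective, ?_⟩
  rintro ⟨_, a, rfl⟩ ⟨_, b, rfl⟩ ⟨_, c, rfl⟩
  rw [hmul, orbitEquivRorb_symm_apply, orbitEquivRorb_symm_apply, orbitEquivRorb_symm_apply]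
  exact Rorb_mem_cmul_iff P a b c
end

section
/- Let A be a commutative ring with identity and G a subgroup of the group A^× of units of A. For a ∈ A let [a] = {ga : g ∈ G} denote its G-orbit under multiplication, and on the set A/G of orbits define the hyperaddition [a] ⊕ [b] = {[c] : c = g₁a + g₂b for some g₁, g₂ ∈ G}. Then the hypergroup (A/G, ⊕) is realizable: the relations R_{[a]} = {(x,y) ∈ A × A : x − y ∈ [a]}, indexed by the orbits, form an association scheme on the set A whose complex multiplication satisfies R_{[c]} ∈ R_{[a]} ⋆ R_{[b]} if and only if [c] ∈ [a] ⊕ [b]. -/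
universe u v

/-- The `G`-orbit `[a] = {g a : g ∈ G}` of `a ∈ A` under a subgroup `G ≤ Aˣ`. -/
def unitOrb {A : Type u} [CommRing A] (G : Subgroup Aˣ) (a : A) : Set A :=
  {b | ∃ g ∈ G, (g : A) * a = b}

/-- The orbit equivalence on `A` induced by a subgroup `G ≤ Aˣ`. -/
def unitSetoid {A : Type u} [CommRing A] (G : Subgroup Aˣ) : Setoid A where
  r a b := ∃ g ∈ G, (g : A) * a = b
  iseqv := by
    refine ⟨fun a => ⟨1, G.one_mem, by simp⟩, ?_, ?_⟩
    · rintro a b ⟨g, hg, rfl⟩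
      exact ⟨g⁻¹, G.inv_mem hg, by rw [← mul_assoc]; simp⟩
    · rintro a b c ⟨g, hg, rfl⟩ ⟨h, hh, rfl⟩
      exact ⟨h * g, G.mul_mem hh hg, by rw [Units.val_mul, mul_assoc]⟩

/-- The class `[a] ∈ A/G` of `a ∈ A`. -/
def umk {A : Type u} [CommRing A] (G : Subgroup Aˣ) (a : A) : Quotient (unitSetoid G) :=
  Quotient.mk (unitSetoid G) a

/-- The hyperaddition of the quotient hypergroup `A/G`:
`[a] ⊕ [b] = {[g₁ a + g₂ b] : g₁, g₂ ∈ G}`. -/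
def hplus {A : Type u} [CommRing A] (G : Subgroup Aˣ) :
    Quotient (unitSetoid G) → Quotient (unitSetoid G) → Set (Quotient (unitSetoid G)) :=
  fun X Y => {Z | ∃ a b : A, X = umk G a ∧ Y = umk G b ∧
    ∃ g₁ ∈ G, ∃ g₂ ∈ G, Z = umk G ((g₁ : A) * a + (g₂ : A) * b)}

/-- The relation `R_{[a]} = {(x, y) : x − y ∈ [a]}` on `A`. -/
def Runit {A : Type u} [CommRing A] (G : Subgroup Aˣ) (a : A) : Set (A × A) :=
  {z | z.1 - z.2 ∈ unitOrb G a}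

theorem umk_eq_umk_iff {A : Type u} [CommRing A] {G : Subgroup Aˣ} {a b : A} :
    umk G a = umk G b ↔ ∃ g ∈ G, (g : A) * a = b :=
  Quotient.eq (r := unitSetoid G)

theorem umk_unit_mul {A : Type u} [CommRing A] {G : Subgroup Aˣ} {g : Aˣ} (hg : g ∈ G) (a : A) :
    umk G ((g : A) * a) = umk G a :=
  (umk_eq_umk_iff.2 ⟨g, hg, rfl⟩).symm

theorem umk_neg {A : Type u} [CommRing A] {G : Subgroup Aˣ} {a b : A} (h : umk G a = umk G b) :
    umk G (-a) = umk G (-b) := by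
  obtain ⟨g, hg, rfl⟩ := umk_eq_umk_iff.1 h
  exact umk_eq_umk_iff.2 ⟨g, hg, by ring⟩

theorem mem_Runit_iff {A : Type u} [CommRing A] {G : Subgroup Aˣ} {a x y : A} :
    (x, y) ∈ Runit G a ↔ umk G a = umk G (x - y) :=
  umk_eq_umk_iff.symm

theorem Runit_eq_Runit_iff {A : Type u} [CommRing A] {G : Subgroup Aˣ} {a b : A} :
    Runit G a = Runit G b ↔ umk G a = umk G b := by
  refine ⟨fun h => ?_, fun h => ?_⟩
  · have ha : (a, (0 : A)) ∈ Runit G a := mem_Runit_iff.2 (by simp)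
    rw [h, mem_Runit_iff, sub_zero] at ha
    exact ha.symm
  · ext ⟨x, y⟩
    rw [mem_Runit_iff, mem_Runit_iff, h]

theorem Runit_zero {A : Type u} [CommRing A] (G : Subgroup Aˣ) : Runit G 0 = diagRel A := by
  ext ⟨x, y⟩
  rw [mem_Runit_iff, umk_eq_umk_iff]
  refine ⟨fun ⟨g, _, h⟩ => ?_, fun h => ⟨1, G.one_mem, ?_⟩⟩
  · exact sub_eq_zero.1 (by rw [← h, mul_zero])
  · have h' : x = y := h
    simp [h']

theorem transposeRel_Runit {A : Type u} [CommRing A] (G : Subgroup Aˣ) (a : A) :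
    transposeRel (Runit G a) = Runit G (-a) := by
  ext ⟨x, y⟩
  change (y, x) ∈ Runit G a ↔ _
  rw [mem_Runit_iff, mem_Runit_iff]
  refine ⟨fun h => ?_, fun h => ?_⟩
  · simpa using umk_neg h
  · simpa using umk_neg h

theorem affine_mem_Runit_iff {A : Type u} [CommRing A] {G : Subgroup Aˣ} {g : Aˣ} (hg : g ∈ G)
    {a x y x' y' : A} (h : x' - y' = (g : A) * (x - y)) :
    (x, y) ∈ Runit G a ↔ (x', y') ∈ Runit G a := by
  rw [mem_Runit_iff, mem_Runit_iff, h, umk_unit_mul hg]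

/-- The affine permutation `x ↦ z' + g (x - z)`. -/
def affinePerm {A : Type u} [CommRing A] (g : Aˣ) (z z' : A) : A ≃ A where
  toFun x := z' + (g : A) * (x - z)
  invFun x := z + ((g⁻¹ : Aˣ) : A) * (x - z')
  left_inv x := by simp
  right_inv x := by simp

theorem isAssocScheme_Runit {A : Type u} [CommRing A] (G : Subgroup Aˣ) :
    IsAssocScheme A {R | ∃ a : A, R = Runit G a} := by
  refine ⟨?_, ?_, ?_, ⟨0, (Runit_zero G).symm⟩, ?_, ?_⟩
  · rintro _ ⟨a, rfl⟩
    exact ⟨(a, 0), mem_Runit_iff.2 (by simp)⟩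
  · rintro ⟨x, y⟩
    exact ⟨_, ⟨x - y, rfl⟩, mem_Runit_iff.2 rfl⟩
  · rintro _ ⟨a, rfl⟩ _ ⟨b, rfl⟩ ⟨⟨x, y⟩, ha, hb⟩
    exact Runit_eq_Runit_iff.2 ((mem_Runit_iff.1 ha).trans (mem_Runit_iff.1 hb).symm)
  · rintro _ ⟨a, rfl⟩
    exact ⟨-a, transposeRel_Runit G a⟩
  · rintro _ ⟨a, rfl⟩ _ ⟨b, rfl⟩ _ ⟨c, rfl⟩ y z y' z' h h'
    obtain ⟨g, hg, hgy⟩ :=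
      umk_eq_umk_iff.1 ((mem_Runit_iff.1 h).symm.trans (mem_Runit_iff.1 h'))
    refine ⟨(affinePerm g z z').subtypeEquiv fun x => and_congr ?_ ?_⟩
    · refine affine_mem_Runit_iff hg ?_
      change y' - (z' + (g : A) * (x - z)) = _
      linear_combination -hgy
    · refine affine_mem_Runit_iff hg ?_
      change z' + (g : A) * (x - z) - z' = _
      ring

theorem Runit_mem_cmul_iff {A : Type u} [CommRing A] (G : Subgroup Aˣ) (a b c : A) :
    Runit G c ∈ cmul {R | ∃ a : A, R = Runit G a} (Runit G a) (Runit G b) ↔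
      umk G c ∈ hplus G (umk G a) (umk G b) := by
  constructor
  · rintro ⟨-, y, x, z, hc, ha, hb⟩
    refine ⟨y - x, x - z, mem_Runit_iff.1 ha, mem_Runit_iff.1 hb,
      1, G.one_mem, 1, G.one_mem, ?_⟩
    simpa using mem_Runit_iff.1 hc
  · rintro ⟨a', b', ha, hb, g, hg, k, hk, hc⟩
    refine ⟨⟨c, rfl⟩, (g : A) * a' + (k : A) * b', (k : A) * b', 0, ?_, ?_, ?_⟩
    · rwa [mem_Runit_iff, sub_zero]
    · rw [mem_Runit_iff, add_sub_cancel_right, umk_unit_mul hg, ha]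
    · rw [mem_Runit_iff, sub_zero, umk_unit_mul hk, hb]

/-- For a commutative ring `A` and a subgroup `G ≤ Aˣ`, the hypergroup
`(A/G, ⊕)` is realizable: the relations `R_{[a]} = {(x, y) : x − y ∈ [a]}`, indexed by the
orbits, form an association scheme on `A` whose complex multiplication satisfies
`R_{[c]} ∈ R_{[a]} ⋆ R_{[b]}` iff `[c] ∈ [a] ⊕ [b]`. -/
theorem quotient_hyperring_realizable {A : Type u} [CommRing A] (G : Subgroup Aˣ)
    (hyp : Hypergroup (Quotient (unitSetoid G))) (hmul : hyp.mul = hplus G) :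
    IsAssocScheme A {R | ∃ a : A, R = Runit G a} ∧
    (∀ a b c : A,
      Runit G c ∈ cmul {R | ∃ a : A, R = Runit G a} (Runit G a) (Runit G b) ↔
        umk G c ∈ hplus G (umk G a) (umk G b)) ∧
    IsRealizable hyp := by
  refine ⟨isAssocScheme_Runit G, Runit_mem_cmul_iff G, A, ⟨0⟩, _, isAssocScheme_Runit G,
    fun p => umk G p.2.choose, ⟨fun p q h => ?_, fun X => ?_⟩, fun p q r => ?_⟩
  · exact Subtype.ext <| p.2.choose_spec.trans <|
      (Runit_eq_Runit_iff.2 h).trans q.2.choose_spec.symm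
  · induction X using Quotient.inductionOn with
    | h a =>
      let p : {R : Set (A × A) // R ∈ {R | ∃ a : A, R = Runit G a}} := ⟨Runit G a, a, rfl⟩
      exact ⟨p, (Runit_eq_Runit_iff.1 p.2.choose_spec).symm⟩
  · rw [hmul, ← Runit_mem_cmul_iff, ← p.2.choose_spec, ← q.2.choose_spec, ← r.2.choose_spec]
end

section
/- The three relations R₀ = {(x,y) ∈ ℚ × ℚ : x = y}, R₊ = {(x,y) ∈ ℚ × ℚ : x − y > 0}, R₋ = {(x,y) ∈ ℚ × ℚ : x − y < 0} form an association scheme on ℚ: they are nonempty and partition ℚ × ℚ, R₀ is the diagonal, the transpose of R₊ is R₋ (and vice versa), and for every triple (p,q,r) of these relations and all (x,z), (x',z') ∈ r, the sets {y ∈ ℚ : (x,y) ∈ p and (y,z) ∈ q} and {y ∈ ℚ : (x',y) ∈ p and (y,z') ∈ q} are equinumerous. Moreover its complex multiplication realizes the hypergroup of signs: R₀ is the identity, R₊ ⋆ R₊ = {R₊}, R₋ ⋆ R₋ = {R₋}, and R₊ ⋆ R₋ = R₋ ⋆ R₊ = {R₀, R₊, R₋}. -/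
universe u v

/-- The equality relation on `ℚ × ℚ`. -/
def Rzero : Set (ℚ × ℚ) := {z | z.1 = z.2}

/-- The positivity relation `x − y > 0` on `ℚ × ℚ`. -/
def Rpos : Set (ℚ × ℚ) := {z | 0 < z.1 - z.2}

/-- The negativity relation `x − y < 0` on `ℚ × ℚ`. -/
def Rneg : Set (ℚ × ℚ) := {z | z.1 - z.2 < 0}

theorem mem_Rzero {x y : ℚ} : (x, y) ∈ Rzero ↔ x = y := Iff.rfl

theorem mem_Rpos {x y : ℚ} : (x, y) ∈ Rpos ↔ y < x := sub_pos (a := x) (b := y)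

theorem mem_Rneg {x y : ℚ} : (x, y) ∈ Rneg ↔ x < y := sub_neg (a := x) (b := y)

/-- Two pairs of rationals in the same position are related by an order automorphism of `ℚ`. -/
theorem exists_orderIso_of_mem {r : Set (ℚ × ℚ)}
    (hr : r ∈ ({Rzero, Rpos, Rneg} : Set (Set (ℚ × ℚ)))) {y z y' z' : ℚ}
    (h : (y, z) ∈ r) (h' : (y', z') ∈ r) : ∃ e : ℚ ≃o ℚ, e y = y' ∧ e z = z' := by
  have key (hne : y - z ≠ 0) (ha : 0 < (y' - z') / (y - z)) :
      ∃ e : ℚ ≃o ℚ, e y = y' ∧ e z = z' := by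
    refine ⟨(OrderIso.mulRight₀ _ ha).trans
      (OrderIso.addRight (z' - z * ((y' - z') / (y - z)))), ?_, ?_⟩
    · simp only [OrderIso.trans_apply, OrderIso.mulRight₀_apply, OrderIso.addRight_apply]
      field_simp
      ring
    · simp
  rcases hr with rfl | rfl | rfl
  · rw [mem_Rzero] at h h'
    subst h h'
    exact ⟨OrderIso.addRight (y' - y), by simp⟩
  · exact key (ne_of_gt h) (div_pos h' h)
  · exact key (ne_of_lt h) (div_pos_of_neg_of_neg h' h)

theorem orderIso_mem_iff {p : Set (ℚ × ℚ)}
    (hp : p ∈ ({Rzero, Rpos, Rneg} : Set (Set (ℚ × ℚ)))) (e : ℚ ≃o ℚ) (x y : ℚ) :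
    (e x, e y) ∈ p ↔ (x, y) ∈ p := by
  rcases hp with rfl | rfl | rfl
  · simp [mem_Rzero]
  · simp [mem_Rpos]
  · simp [mem_Rneg]

theorem transposeRel_Rzero : transposeRel Rzero = Rzero := by
  ext ⟨x, y⟩
  exact eq_comm

theorem transposeRel_Rpos : transposeRel Rpos = Rneg := by
  ext ⟨x, y⟩
  exact mem_Rpos.trans mem_Rneg.symm

theorem transposeRel_Rneg : transposeRel Rneg = Rpos := by
  ext ⟨x, y⟩
  exact mem_Rneg.trans mem_Rpos.symm

theorem nonempty_of_mem_signs {p : Set (ℚ × ℚ)}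
    (hp : p ∈ ({Rzero, Rpos, Rneg} : Set (Set (ℚ × ℚ)))) : p.Nonempty := by
  rcases hp with rfl | rfl | rfl
  · exact ⟨(0, 0), mem_Rzero.2 rfl⟩
  · exact ⟨(1, 0), mem_Rpos.2 one_pos⟩
  · exact ⟨(0, 1), mem_Rneg.2 one_pos⟩

theorem eq_of_mem_signs {p q : Set (ℚ × ℚ)}
    (hp : p ∈ ({Rzero, Rpos, Rneg} : Set (Set (ℚ × ℚ))))
    (hq : q ∈ ({Rzero, Rpos, Rneg} : Set (Set (ℚ × ℚ)))) {x y : ℚ}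
    (hxp : (x, y) ∈ p) (hxq : (x, y) ∈ q) : p = q := by
  rcases hp with rfl | rfl | rfl <;> rcases hq with rfl | rfl | rfl <;>
    first
    | rfl
    | (simp only [mem_Rzero, mem_Rpos, mem_Rneg] at hxp hxq
       exfalso
       linarith)

theorem isAssocScheme_signs : IsAssocScheme ℚ {Rzero, Rpos, Rneg} := by
  refine ⟨fun p hp => nonempty_of_mem_signs hp, ?_, ?_, Or.inl rfl, ?_, ?_⟩
  · rintro ⟨x, y⟩
    rcases lt_trichotomy x y with h | h | h
    · exact ⟨Rneg, by simp, mem_Rneg.2 h⟩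
    · exact ⟨Rzero, by simp, mem_Rzero.2 h⟩
    · exact ⟨Rpos, by simp, mem_Rpos.2 h⟩
  · rintro p hp q hq ⟨⟨x, y⟩, hxp, hxq⟩
    exact eq_of_mem_signs hp hq hxp hxq
  · rintro p (rfl | rfl | rfl)
    · simp [transposeRel_Rzero]
    · simp [transposeRel_Rpos]
    · simp [transposeRel_Rneg]
  · intro p hp q hq r hr y z y' z' h h'
    obtain ⟨e, rfl, rfl⟩ := exists_orderIso_of_mem hr h h'
    exact ⟨e.toEquiv.subtypeEquiv fun x =>
      (and_congr (orderIso_mem_iff hp e y x) (orderIso_mem_iff hq e x z)).symm⟩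

/-- If every composite of `p` and `q` lies in `s`, then `p ⋆ q` is the singleton `{s}`. -/
theorem cmul_signs_eq_singleton {p q s : Set (ℚ × ℚ)}
    (hs : s ∈ ({Rzero, Rpos, Rneg} : Set (Set (ℚ × ℚ))))
    (hsub : ∀ y x z : ℚ, (y, x) ∈ p → (x, z) ∈ q → (y, z) ∈ s)
    (hex : ∃ y x z : ℚ, (y, x) ∈ p ∧ (x, z) ∈ q) :
    cmul {Rzero, Rpos, Rneg} p q = {s} := by
  ext r
  constructor
  · rintro ⟨hr, y, x, z, hyz, hyx, hxz⟩
    exact eq_of_mem_signs hr hs hyz (hsub y x z hyx hxz)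
  · rintro rfl
    obtain ⟨y, x, z, hyx, hxz⟩ := hex
    exact ⟨hs, y, x, z, hsub y x z hyx hxz, hyx, hxz⟩

theorem cmul_Rpos_Rneg : cmul {Rzero, Rpos, Rneg} Rpos Rneg = {Rzero, Rpos, Rneg} := by
  refine Set.Subset.antisymm (fun r hr => hr.1) fun r hr => ⟨hr, ?_⟩
  obtain ⟨⟨y, z⟩, h⟩ := nonempty_of_mem_signs hr
  obtain ⟨x, hxy, hxz⟩ := (exists_lt (min y z)).imp fun _ => lt_min_iff.1
  exact ⟨y, x, z, h, mem_Rpos.2 hxy, mem_Rneg.2 hxz⟩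

theorem cmul_Rneg_Rpos : cmul {Rzero, Rpos, Rneg} Rneg Rpos = {Rzero, Rpos, Rneg} := by
  refine Set.Subset.antisymm (fun r hr => hr.1) fun r hr => ⟨hr, ?_⟩
  obtain ⟨⟨y, z⟩, h⟩ := nonempty_of_mem_signs hr
  obtain ⟨x, hyx, hzx⟩ := (exists_gt (max y z)).imp fun _ => max_lt_iff.1
  exact ⟨y, x, z, h, mem_Rneg.2 hyx, mem_Rpos.2 hzx⟩

/-- The three relations `R₀`, `R₊`, `R₋` form an association scheme on `ℚ`
whose complex multiplication realizes the hypergroup of signs: `R₀` is the diagonal and the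
identity, `R₊` and `R₋` are transposes of each other, `R₊ ⋆ R₊ = {R₊}`, `R₋ ⋆ R₋ = {R₋}`, and
`R₊ ⋆ R₋ = R₋ ⋆ R₊ = {R₀, R₊, R₋}`. -/
theorem sign_assocScheme :
    IsAssocScheme ℚ {Rzero, Rpos, Rneg} ∧
    Rzero = diagRel ℚ ∧
    transposeRel Rpos = Rneg ∧
    transposeRel Rneg = Rpos ∧
    (∀ p ∈ ({Rzero, Rpos, Rneg} : Set (Set (ℚ × ℚ))),
      cmul {Rzero, Rpos, Rneg} Rzero p = {p} ∧ cmul {Rzero, Rpos, Rneg} p Rzero = {p}) ∧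
    cmul {Rzero, Rpos, Rneg} Rpos Rpos = {Rpos} ∧
    cmul {Rzero, Rpos, Rneg} Rneg Rneg = {Rneg} ∧
    cmul {Rzero, Rpos, Rneg} Rpos Rneg = {Rzero, Rpos, Rneg} ∧
    cmul {Rzero, Rpos, Rneg} Rneg Rpos = {Rzero, Rpos, Rneg} := by
  refine ⟨isAssocScheme_signs, rfl, transposeRel_Rpos, transposeRel_Rneg,
    fun p hp => ⟨?_, ?_⟩, ?_, ?_, cmul_Rpos_Rneg, cmul_Rneg_Rpos⟩
  · obtain ⟨⟨y, z⟩, h⟩ := nonempty_of_mem_signs hp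
    refine cmul_signs_eq_singleton hp ?_ ⟨y, y, z, rfl, h⟩
    rintro a b c hab hbc
    rwa [mem_Rzero.1 hab]
  · obtain ⟨⟨y, z⟩, h⟩ := nonempty_of_mem_signs hp
    refine cmul_signs_eq_singleton hp ?_ ⟨y, z, z, h, rfl⟩
    rintro a b c hab hbc
    rwa [← mem_Rzero.1 hbc]
  · refine cmul_signs_eq_singleton (by simp) ?_
      ⟨2, 1, 0, mem_Rpos.2 one_lt_two, mem_Rpos.2 one_pos⟩
    exact fun a b c hab hbc => mem_Rpos.2 ((mem_Rpos.1 hbc).trans (mem_Rpos.1 hab))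
  · refine cmul_signs_eq_singleton (by simp) ?_
      ⟨0, 1, 2, mem_Rneg.2 one_pos, mem_Rneg.2 one_lt_two⟩
    exact fun a b c hab hbc => mem_Rneg.2 ((mem_Rneg.1 hab).trans (mem_Rneg.1 hbc))
end

section
/- Let F be a field, Γ₀ a linearly ordered commutative group with zero, and v : F → Γ₀ a surjective valuation satisfying the triangle condition. For g ∈ Γ₀ let F_g = {(a,b) ∈ F × F : v(a − b) = g}. Then {F_g : g ∈ Γ₀} is an association scheme on F: each F_g is nonempty and the F_g partition F × F; F_0 is the diagonal; each F_g equals its own transpose; and for all g, h, k ∈ Γ₀ and all (a,b), (a',b') ∈ F_k, the sets {y ∈ F : v(a − y) = g and v(y − b) = h} and {y ∈ F : v(a' − y) = g and v(y − b') = h} are equinumerous. -/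
universe u v

/-- The triangle condition for a valuation `v` (multiplicative convention): for any two pairs
at the same "distance" `r = v(a−b) = v(a'−b')`, the two sets of apexes of isoceles triangles
over them with both legs of distance `r` are nonempty and equinumerous. -/
def TriangleCond {F : Type u} {Γ₀ : Type v} [Field F] [LinearOrderedCommGroupWithZero Γ₀]
    (v : Valuation F Γ₀) : Prop :=
  ∀ a b a' b' : F, v (a - b) = v (a' - b') →
    ({y : F | v (a - y) = v (a - b) ∧ v (y - b) = v (a - b)}).Nonempty ∧
    Nonempty ({y : F // v (a - y) = v (a - b) ∧ v (y - b) = v (a - b)} ≃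
      {y : F // v (a' - y) = v (a' - b') ∧ v (y - b') = v (a' - b')})

/-- The relation `F_g = {(a, b) : v(a − b) = g}` on `F` associated to a value `g ∈ Γ₀`. -/
def valRel {F : Type u} {Γ₀ : Type v} [Field F] [LinearOrderedCommGroupWithZero Γ₀]
    (v : Valuation F Γ₀) (g : Γ₀) : Set (F × F) :=
  {z | v (z.1 - z.2) = g}

/-- Two elements of a field with the same value differ by a factor of value one. -/
theorem exists_mul_eq_of_valuation_eq {F : Type u} {Γ₀ : Type v}
    [Field F] [LinearOrderedCommGroupWithZero Γ₀]
    (v : Valuation F Γ₀) {c c' : F} (h : v c = v c') : ∃ u : F, v u = 1 ∧ c * u = c' := by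
  by_cases hc : c = 0
  · subst hc
    rw [map_zero, eq_comm, map_eq_zero] at h
    exact ⟨1, map_one v, by simp [h]⟩
  · refine ⟨c' / c, ?_, mul_div_cancel₀ c' hc⟩
    rw [map_div₀, ← h, div_self ((map_ne_zero v).2 hc)]

/-- Triangle sets over two pairs at the same distance are equinumerous: multiplying by a factor
of value one carries one onto the other. -/
theorem nonempty_triangle_equiv {F : Type u} {Γ₀ : Type v}
    [Field F] [LinearOrderedCommGroupWithZero Γ₀]
    (v : Valuation F Γ₀) (g h : Γ₀) {a b a' b' : F} (hab : v (a - b) = v (a' - b')) :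
    Nonempty ({x : F // v (a - x) = g ∧ v (x - b) = h} ≃
      {x : F // v (a' - x) = g ∧ v (x - b') = h}) := by
  obtain ⟨u, hu, hc⟩ := exists_mul_eq_of_valuation_eq v hab
  have hu0 : u ≠ 0 := by
    rintro rfl
    simp at hu
  let e : F ≃ F := (Equiv.subLeft a).trans ((Equiv.mulRight₀ u hu0).trans (Equiv.subLeft a'))
  refine ⟨e.subtypeEquiv fun x => ?_⟩
  have h₁ : a' - e x = (a - x) * u := by simp [e]
  have h₂ : e x - b' = (x - b) * u := by
    linear_combination -h₁ - hc
  rw [h₁, h₂, map_mul, map_mul, hu, mul_one, mul_one]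

theorem valRel_zero {F : Type u} {Γ₀ : Type v} [Field F] [LinearOrderedCommGroupWithZero Γ₀]
    (v : Valuation F Γ₀) : valRel v 0 = diagRel F := by
  ext z
  simp [valRel, diagRel, sub_eq_zero]

theorem transposeRel_valRel {F : Type u} {Γ₀ : Type v}
    [Field F] [LinearOrderedCommGroupWithZero Γ₀]
    (v : Valuation F Γ₀) (g : Γ₀) : transposeRel (valRel v g) = valRel v g := by
  ext z
  simp [valRel, transposeRel, v.map_sub_swap z.2 z.1]

/-- For a surjective valuation `v : F → Γ₀` on a field satisfying the
triangle condition, the relations `F_g = {(a, b) : v(a − b) = g}`, `g ∈ Γ₀`, form an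
association scheme on `F`: they are nonempty and partition `F × F`, `F_0` is the diagonal,
each `F_g` is its own transpose, and all triangle sets over a fixed triple are equinumerous. -/
theorem valuation_assocScheme {F : Type u} {Γ₀ : Type v}
    [Field F] [LinearOrderedCommGroupWithZero Γ₀]
    (v : Valuation F Γ₀) (hsurj : Function.Surjective v) (htri : TriangleCond v) :
    IsAssocScheme F {R | ∃ g : Γ₀, R = valRel v g} ∧
    valRel v 0 = diagRel F ∧
    (∀ g : Γ₀, transposeRel (valRel v g) = valRel v g) := by
  refine ⟨⟨?_, ?_, ?_, ⟨0, (valRel_zero v).symm⟩, ?_, ?_⟩, valRel_zero v, transposeRel_valRel v⟩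
  · rintro _ ⟨g, rfl⟩
    obtain ⟨x, rfl⟩ := hsurj g
    exact ⟨(x, 0), by simp [valRel]⟩
  · exact fun z => ⟨_, ⟨v (z.1 - z.2), rfl⟩, rfl⟩
  · rintro _ ⟨g, rfl⟩ _ ⟨h, rfl⟩ ⟨z, hg, hh⟩
    rw [← show v (z.1 - z.2) = g from hg, ← show v (z.1 - z.2) = h from hh]
  · rintro _ ⟨g, rfl⟩
    exact ⟨g, transposeRel_valRel v g⟩
  · rintro _ ⟨g, rfl⟩ _ ⟨h, rfl⟩ _ ⟨k, rfl⟩ a b a' b' hab hab'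
    exact nonempty_triangle_equiv v g h (Eq.trans hab (Eq.symm hab'))
end

section
/- Let F be a field, Γ₀ a linearly ordered commutative group with zero, and v : F → Γ₀ a valuation. Let a, b, a', b' ∈ F and r, p ∈ Γ₀ with v(a − b) = v(a' − b') = r and r < p. Then the map y ↦ y − (a − a') is a bijection from the set A = {y ∈ F : v(a − y) = p and v(y − b) = p} onto the set A' = {y ∈ F : v(a' − y) = p and v(y − b') = p}. Moreover, if p lies in the image of v, then A is nonempty. -/
universe u v

/-- If `v (a - b) < v (a - y)`, then `y` is equidistant from `a` and `b`. -/
theorem Valuation.map_sub_eq_of_map_sub_lt {R : Type u} {Γ₀ : Type v}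
    [Ring R] [LinearOrderedCommMonoidWithZero Γ₀]
    (v : Valuation R Γ₀) {a b y : R} (h : v (a - b) < v (a - y)) :
    v (y - b) = v (a - y) := by
  rw [← v.map_sub_eq_of_lt_right h, sub_sub_sub_cancel_left]

/-- Let `v : F → Γ₀` be a valuation on a field (multiplicative convention),
`a, b, a', b' ∈ F` and `r, p ∈ Γ₀` with `v(a − b) = v(a' − b') = r < p`. Then
`y ↦ y − (a − a')` is a bijection from `A = {y : v(a − y) = p ∧ v(y − b) = p}` onto
`A' = {y : v(a' − y) = p ∧ v(y − b') = p}`; moreover if `p` is in the image of `v`, then `A`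
is nonempty. -/
theorem triangle_set_bijection {F : Type u} {Γ₀ : Type v}
    [Field F] [LinearOrderedCommGroupWithZero Γ₀]
    (v : Valuation F Γ₀) (a b a' b' : F) (r p : Γ₀)
    (hab : v (a - b) = r) (hab' : v (a' - b') = r) (hrp : r < p) :
    Set.BijOn (fun y => y - (a - a'))
      {y : F | v (a - y) = p ∧ v (y - b) = p}
      {y : F | v (a' - y) = p ∧ v (y - b') = p} ∧
    ((∃ w : F, v w = p) → ({y : F | v (a - y) = p ∧ v (y - b) = p}).Nonempty) := by
  refine ⟨⟨?_, sub_left_injective.injOn, ?_⟩, ?_⟩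
  · rintro y ⟨hy, -⟩
    have h : v (a' - (y - (a - a'))) = p := by rw [← hy]; congr 1; ring
    exact ⟨h, (v.map_sub_eq_of_map_sub_lt (by rwa [hab', h])).trans h⟩
  · rintro y ⟨hy, -⟩
    have h : v (a - (y + (a - a'))) = p := by rw [← hy]; congr 1; ring
    exact ⟨y + (a - a'), ⟨h, (v.map_sub_eq_of_map_sub_lt (by rwa [hab, h])).trans h⟩,
      add_sub_cancel_right _ _⟩
  · rintro ⟨w, hw⟩
    have h : v (a - (a - w)) = p := by rw [sub_sub_cancel, hw]
    exact ⟨a - w, h, (v.map_sub_eq_of_map_sub_lt (by rwa [hab, h])).trans h⟩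
end
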